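/- arXiv:1112.0852 — 2 statements merged into one kernel-verified Lean document; each statement's English description precedes it below -/
import Mathlib

section
/- For an artin algebra A, the infinite radical rad_A^∞ of the module category mod A (the intersection of all powers rad_A^i) is zero if and only if A is of finite representation type, i.e., there are only finitely many indecomposable finitely generated A-modules up to isomorphism. -/
universe u

variable {A : Type u} [Ring A]

/-- The category of (right) `A`-modules, modeled as modules over `Aᵐᵒᵖ`. -/
abbrev Modc (A : Type u) [Ring A] := ModuleCat.{u} Aᵐᵒᵖ

/-- A module is finitely generated. -/
def FinGen (M : Modc A) : Prop := Module.Finite Aᵐᵒᵖ M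

/-- A module is indecomposable: nonzero, and its endomorphism ring has no
nontrivial idempotents. -/
def Indec (M : Modc A) : Prop :=
  Nontrivial M ∧ ∀ e : M →ₗ[Aᵐᵒᵖ] M, e ∘ₗ e = e → e = 0 ∨ e = LinearMap.id

def IsSplitMono {M N : Modc A} (f : M →ₗ[Aᵐᵒᵖ] N) : Prop :=
  ∃ g : N →ₗ[Aᵐᵒᵖ] M, g ∘ₗ f = LinearMap.id

def IsSplitEpi {M N : Modc A} (f : M →ₗ[Aᵐᵒᵖ] N) : Prop :=
  ∃ g : N →ₗ[Aᵐᵒᵖ] M, f ∘ₗ g = LinearMap.id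

/-- An irreducible morphism between modules. -/
def IsIrred {M N : Modc A} (f : M →ₗ[Aᵐᵒᵖ] N) : Prop :=
  ¬ IsSplitMono f ∧ ¬ IsSplitEpi f ∧
  ∀ (L : Modc A) (g : M →ₗ[Aᵐᵒᵖ] L) (h : L →ₗ[Aᵐᵒᵖ] N),
    h ∘ₗ g = f → IsSplitEpi h ∨ IsSplitMono g

/-- Neighbors in the Auslander-Reiten quiver: both finitely generated
indecomposable, and isomorphic or linked by an irreducible map. -/
def Neighbor (X Y : Modc A) : Prop :=
  FinGen X ∧ FinGen Y ∧ Indec X ∧ Indec Y ∧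
  (Nonempty (X ≃ₗ[Aᵐᵒᵖ] Y) ∨ (∃ f : X →ₗ[Aᵐᵒᵖ] Y, IsIrred f) ∨
    (∃ f : Y →ₗ[Aᵐᵒᵖ] X, IsIrred f))

/-- A component of the Auslander-Reiten quiver `Γ_A`, viewed as the class of
indecomposable finitely generated modules lying in it. -/
def IsARComponent (C : Set (Modc A)) : Prop :=
  C.Nonempty ∧ (∀ X ∈ C, FinGen X ∧ Indec X) ∧
  (∀ X ∈ C, ∀ Y : Modc A, Neighbor X Y → Y ∈ C) ∧
  (∀ X ∈ C, ∀ Y ∈ C, Relation.ReflTransGen Neighbor X Y)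

/-- The annihilator of a class of modules. -/
def annSet (C : Set (Modc A)) : Set A :=
  {a | ∀ X ∈ C, ∀ x : X, MulOpposite.op a • x = 0}

/-- The annihilator of a single module. -/
def annM (M : Modc A) : Set A := {a | ∀ x : M, MulOpposite.op a • x = 0}

/-- Membership in `add C`: isomorphic to a finite direct sum of modules in `C`. -/
def InAdd (C : Set (Modc A)) (M : Modc A) : Prop :=
  ∃ (k : ℕ) (F : Fin k → Modc A), (∀ i, F i ∈ C) ∧
    Nonempty (M ≃ₗ[Aᵐᵒᵖ] ((i : Fin k) → F i))

/-- An external short path of `C`: nonzero non-isomorphisms `X → Y → Z` between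
indecomposables with `X, Z ∈ C` and `Y ∉ C`. -/
def HasExtShortPath (C : Set (Modc A)) : Prop :=
  ∃ X Y Z : Modc A, X ∈ C ∧ Z ∈ C ∧ Y ∉ C ∧ FinGen Y ∧ Indec Y ∧
    (∃ f : X →ₗ[Aᵐᵒᵖ] Y, f ≠ 0 ∧ ¬ Function.Bijective f) ∧
    (∃ g : Y →ₗ[Aᵐᵒᵖ] Z, g ≠ 0 ∧ ¬ Function.Bijective g)

/-- Projective dimension at most one. -/
def PdLE1 (X : Modc A) : Prop :=
  ∃ (P₁ P₀ : Modc A) (f : P₁ →ₗ[Aᵐᵒᵖ] P₀) (g : P₀ →ₗ[Aᵐᵒᵖ] X),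
    Module.Projective Aᵐᵒᵖ P₁ ∧ Module.Projective Aᵐᵒᵖ P₀ ∧
    Function.Injective f ∧ Function.Surjective g ∧
    LinearMap.range f = LinearMap.ker g

/-- Projective dimension at most two. -/
def PdLE2 (X : Modc A) : Prop :=
  ∃ (P₂ P₁ P₀ : Modc A) (f : P₂ →ₗ[Aᵐᵒᵖ] P₁) (g : P₁ →ₗ[Aᵐᵒᵖ] P₀)
    (h : P₀ →ₗ[Aᵐᵒᵖ] X),
    Module.Projective Aᵐᵒᵖ P₂ ∧ Module.Projective Aᵐᵒᵖ P₁ ∧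
    Module.Projective Aᵐᵒᵖ P₀ ∧
    Function.Injective f ∧ Function.Surjective h ∧
    LinearMap.range f = LinearMap.ker g ∧ LinearMap.range g = LinearMap.ker h

/-- Injective dimension at most one. -/
def IdLE1 (X : Modc A) : Prop :=
  ∃ (I₀ I₁ : Modc A) (f : X →ₗ[Aᵐᵒᵖ] I₀) (g : I₀ →ₗ[Aᵐᵒᵖ] I₁),
    Module.Injective Aᵐᵒᵖ I₀ ∧ Module.Injective Aᵐᵒᵖ I₁ ∧
    Function.Injective f ∧ Function.Surjective g ∧
    LinearMap.range f = LinearMap.ker g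

/-- An almost split (Auslander-Reiten) sequence `0 → T → E → X → 0`; then
`T = τ_A X` and `X = τ_A⁻ T`. -/
def IsAlmostSplitSeq (T E X : Modc A) (f : T →ₗ[Aᵐᵒᵖ] E) (g : E →ₗ[Aᵐᵒᵖ] X) : Prop :=
  Function.Injective f ∧ Function.Surjective g ∧
  LinearMap.range f = LinearMap.ker g ∧
  Indec T ∧ Indec X ∧ ¬ IsSplitEpi g ∧
  (∀ (V : Modc A) (h : V →ₗ[Aᵐᵒᵖ] X), ¬ IsSplitEpi h → ∃ k : V →ₗ[Aᵐᵒᵖ] E, g ∘ₗ k = h) ∧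
  (∀ (V : Modc A) (h : T →ₗ[Aᵐᵒᵖ] V), ¬ IsSplitMono h → ∃ k : E →ₗ[Aᵐᵒᵖ] V, k ∘ₗ f = h)

/-- A generator of the radical of `mod A`: a map factoring through a
non-isomorphism between finitely generated indecomposables. -/
def IsNonIsoGen {X Y : Modc A} (f : X →ₗ[Aᵐᵒᵖ] Y) : Prop :=
  ∃ (M N : Modc A) (u : M →ₗ[Aᵐᵒᵖ] N) (g : X →ₗ[Aᵐᵒᵖ] M) (h : N →ₗ[Aᵐᵒᵖ] Y),
    FinGen M ∧ Indec M ∧ FinGen N ∧ Indec N ∧ ¬ Function.Bijective u ∧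
    f = h ∘ₗ (u ∘ₗ g)

/-- The radical `rad_A(X, Y)`: the ideal of `mod A` generated by all
non-isomorphisms between indecomposables. -/
def rad1 (X Y : Modc A) : AddSubgroup (X →ₗ[Aᵐᵒᵖ] Y) :=
  AddSubgroup.closure {f | IsNonIsoGen f}

/-- Powers of the radical: `radPow n = rad_A^(n+1)`. -/
def radPow : ℕ → (X Y : Modc A) → AddSubgroup (X →ₗ[Aᵐᵒᵖ] Y)
  | 0 => rad1
  | n + 1 => fun X Y => AddSubgroup.closure
      {f | ∃ (Z : Modc A) (g : X →ₗ[Aᵐᵒᵖ] Z) (h : Z →ₗ[Aᵐᵒᵖ] Y),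
        FinGen Z ∧ g ∈ radPow n X Z ∧ h ∈ rad1 Z Y ∧ f = h ∘ₗ g}

/-- The infinite radical `rad_A^∞(X, Y) = ⋂_{i ≥ 1} rad_A^i(X, Y)`. -/
def radInf (X Y : Modc A) : AddSubgroup (X →ₗ[Aᵐᵒᵖ] Y) := ⨅ n : ℕ, radPow n X Y

/-- `X` is (isomorphic to) a direct summand of `M`. -/
def IsDirectSummandOf (X M : Modc A) : Prop :=
  ∃ (ι : X →ₗ[Aᵐᵒᵖ] M) (ρ : M →ₗ[Aᵐᵒᵖ] X), ρ ∘ₗ ι = LinearMap.id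
section Dualizer

/-- A finitely generated injective cogenerator over a commutative ring for which every finitely
generated module is reflexive. -/
structure IsDualizer (K : Type u) [CommRing K] (E : Type u) [AddCommGroup E] [Module K E] :
    Prop where
  finite : Module.Finite K E
  injective : Module.Injective K E
  exists_ne : ∀ (M : Type u) [AddCommGroup M] [Module K M] (x : M), x ≠ 0 →
    ∃ φ : M →ₗ[K] E, φ x ≠ 0
  reflexive : ∀ (M : Type u) [AddCommGroup M] [Module K M], Module.Finite K M →
    ∀ Φ : (M →ₗ[K] E) →ₗ[K] E, ∃ x : M, ∀ φ, Φ φ = φ x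

variable {K : Type u} [CommRing K]

/-- Every nonzero element of `N` has a nonzero multiple in `T`. -/
def EssentiallyContains {Q : Type u} [AddCommGroup Q] [Module K Q] (T N : Submodule K Q) : Prop :=
  ∀ x ∈ N, x ≠ 0 → ∃ k : K, k • x ≠ 0 ∧ k • x ∈ T

lemma exists_maximal_essential {Q : Type u} [AddCommGroup Q] [Module K Q] (T : Submodule K Q) :
    ∃ N : Submodule K Q, T ≤ N ∧ EssentiallyContains T N ∧
      ∀ N', N ≤ N' → EssentiallyContains T N' → N' ≤ N := by
  obtain ⟨N, hTN, hN⟩ := zorn_le_nonempty₀ {N : Submodule K Q | EssentiallyContains T N}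
    (fun c hc hchain y hy => by
      refine ⟨sSup c, fun x hx hx0 => ?_, fun z hz => le_sSup hz⟩
      obtain ⟨z, hz, hxz⟩ := (Submodule.mem_sSup_of_directed ⟨y, hy⟩ hchain.directedOn).1 hx
      exact hc hz x hxz hx0) T (fun x hx hx0 => ⟨1, by simpa using hx0, by simpa using hx⟩)
  exact ⟨N, hTN, hN.1, fun N' h h' => hN.2 h' h⟩

lemma exists_maximal_disjoint {Q : Type u} [AddCommGroup Q] [Module K Q] (N : Submodule K Q) :
    ∃ C : Submodule K Q, (∀ x ∈ N, x ∈ C → x = 0) ∧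
      ∀ C', C ≤ C' → (∀ x ∈ N, x ∈ C' → x = 0) → C' ≤ C := by
  obtain ⟨C, -, hC⟩ := zorn_le_nonempty₀ {C : Submodule K Q | ∀ x ∈ N, x ∈ C → x = 0}
    (fun c hc hchain y hy => by
      refine ⟨sSup c, fun x hx hx0 => ?_, fun z hz => le_sSup hz⟩
      obtain ⟨z, hz, hxz⟩ := (Submodule.mem_sSup_of_directed ⟨y, hy⟩ hchain.directedOn).1 hx0
      exact hc hz x hx hxz) ⊥ (fun x _ hx => by simpa using hx)
  exact ⟨C, hC.1, fun C' h h' => hC.2 h' h⟩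

/-- Inside an injective module, a maximal essential extension is injective. -/
lemma injective_of_maximal_essential {Q : Type u} [AddCommGroup Q] [Module K Q]
    [hQ : Module.Injective K Q] {T N : Submodule K Q} (hN : EssentiallyContains T N)
    (hmax : ∀ N', N ≤ N' → EssentiallyContains T N' → N' ≤ N) :
    Module.Injective K N := by
  obtain ⟨C, hC, hCmax⟩ := exists_maximal_disjoint N
  let i : N →ₗ[K] Q ⧸ C := C.mkQ ∘ₗ N.subtype
  have hi : Function.Injective i := by
    rw [← LinearMap.ker_eq_bot, LinearMap.ker_eq_bot']
    intro x hx
    exact Subtype.ext (hC x x.2 ((Submodule.Quotient.mk_eq_zero C).1 hx))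
  have hess : ∀ z : Q ⧸ C, z ≠ 0 → ∃ (k : K) (x : N), x ≠ 0 ∧ k • z = i x := by
    intro z hz
    obtain ⟨q, rfl⟩ := C.mkQ_surjective z
    have hq : q ∉ C := fun h => hz ((Submodule.Quotient.mk_eq_zero C).2 h)
    by_contra! hcon
    refine hq (hCmax (C ⊔ Submodule.span K {q}) le_sup_left ?_
      (Submodule.mem_sup_right (Submodule.mem_span_singleton_self q)))
    intro x hx hx'
    obtain ⟨c, hc, y, hy, rfl⟩ := Submodule.mem_sup.1 hx'
    obtain ⟨k, rfl⟩ := Submodule.mem_span_singleton.1 hy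
    by_contra hne
    refine hcon k ⟨_, hx⟩ (fun h => hne (congrArg Subtype.val h)) ?_
    simp [i, (Submodule.Quotient.mk_eq_zero C).2 hc]
  obtain ⟨g, hg⟩ := hQ.out i hi N.subtype
  have hginj : ∀ z, g z = 0 → z = 0 := by
    intro z hz
    by_contra hne
    obtain ⟨k, x, hx, hkx⟩ := hess z hne
    have : g (i x) = 0 := by rw [← hkx, map_smul, hz, smul_zero]
    rw [hg] at this
    exact hx (Subtype.ext this)
  have hrange : LinearMap.range g ≤ N := by
    refine hmax _ (fun x hx => ⟨i ⟨x, hx⟩, hg _⟩) ?_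
    rintro _ ⟨z, rfl⟩ hz
    obtain ⟨k, x, hx, hkx⟩ := hess z (fun h => hz (by rw [h, map_zero]))
    obtain ⟨l, hl, hl'⟩ := hN x x.2 (fun h => hx (Subtype.ext h))
    have : (l * k) • g z = l • (x : Q) := by
      rw [mul_smul, ← map_smul g k, hkx, hg]; rfl
    exact ⟨l * k, this ▸ hl, this ▸ hl'⟩
  let r : Q →ₗ[K] N := (g ∘ₗ C.mkQ).codRestrict N (fun q => hrange ⟨_, rfl⟩)
  have hr : ∀ x : N, r x = x := fun x => Subtype.ext (hg x)
  refine ⟨fun X Y _ _ _ _ f hf φ => ?_⟩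
  obtain ⟨h, hh⟩ := hQ.out f hf (N.subtype ∘ₗ φ)
  exact ⟨r ∘ₗ h, fun x => by simp [hh, hr]⟩

lemma exists_injective_embedding (M : Type u) [AddCommGroup M] [Module K M] :
    ∃ (Q : Type u) (_ : AddCommGroup Q) (_ : Module K Q) (j : M →ₗ[K] Q),
      Module.Injective K Q ∧ Function.Injective j := by
  let Q : ModuleCat.{u} K := CategoryTheory.Injective.under (ModuleCat.of K M)
  let j : ModuleCat.of K M ⟶ Q := CategoryTheory.Injective.ι _
  have hQ : CategoryTheory.Injective (ModuleCat.of K Q) :=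
    inferInstanceAs (CategoryTheory.Injective (CategoryTheory.Injective.under (ModuleCat.of K M)))
  refine ⟨Q, inferInstance, inferInstance, j.hom,
    Module.injective_module_of_injective_object K Q, ?_⟩
  exact (ModuleCat.mono_iff_injective j).1 inferInstance

lemma length_dual_simple_le {Q : Type u} [AddCommGroup Q] [Module K Q]
    (j : (∀ m : MaximalSpectrum K, K ⧸ m.asIdeal) →ₗ[K] Q) (hj : Function.Injective j)
    {N : Submodule K Q} (hN : EssentiallyContains (LinearMap.range j) N)
    (S : Type u) [AddCommGroup S] [Module K S] [hS : IsSimpleModule K S] :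
    Module.length K (S →ₗ[K] N) ≤ 1 := by
  classical
  rcases subsingleton_or_nontrivial (S →ₗ[K] N) with hsub | hnt
  · simp [Module.length_eq_zero]
  refine le_of_eq (Module.length_eq_one_iff.2 ?_)
  obtain ⟨I, hI, ⟨e⟩⟩ := isSimpleModule_iff_quot_maximal.1 hS
  let s : S := e.symm 1
  have hs : ∀ x : S, ∃ k : K, x = k • s := fun x => by
    obtain ⟨k, hk⟩ := Ideal.Quotient.mk_surjective (e x)
    refine ⟨k, e.injective ?_⟩
    simp only [s, map_smul, LinearEquiv.apply_symm_apply, ← hk]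
    rw [Algebra.smul_def, mul_one]; rfl
  have hIs : ∀ k ∈ I, k • s = 0 := fun k hk => e.injective (by
    simp only [s, map_smul, LinearEquiv.apply_symm_apply, map_zero]
    rw [Algebra.smul_def, mul_one]; exact Ideal.Quotient.eq_zero_iff_mem.2 hk)
  let m : MaximalSpectrum K := ⟨I, hI⟩
  -- every value on the generator is a multiple of one element
  have key : ∀ φ : S →ₗ[K] N, ∃ k : K,
      ((φ s : N) : Q) = j (Pi.single m (Ideal.Quotient.mk _ k)) := by
    intro φ
    by_cases h0 : ((φ s : N) : Q) = 0
    · exact ⟨0, by simp [h0]⟩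
    obtain ⟨l, hl, y, hy⟩ := hN _ (φ s).2 h0
    have hlI : l ∉ I := fun h => hl (by
      have : l • φ s = 0 := by rw [← map_smul, hIs l h, map_zero]
      exact congrArg Subtype.val this)
    obtain ⟨a, b, hb, hab⟩ := hI.exists_inv hlI
    have hz : ((φ s : N) : Q) = j (a • y) := by
      have : b • φ s = 0 := by rw [← map_smul, hIs b hb, map_zero]
      have h2 : b • ((φ s : N) : Q) = 0 := congrArg Subtype.val this
      rw [map_smul, hy, ← mul_smul]
      conv_lhs => rw [← one_smul K ((φ s : N) : Q), ← hab, add_smul, h2, add_zero]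
    have hkill : ∀ k ∈ I, k • (a • y) = 0 := fun k hk => hj (by
      have : k • φ s = 0 := by rw [← map_smul, hIs k hk, map_zero]
      rw [map_smul, ← hz, map_zero]
      exact congrArg Subtype.val this)
    obtain ⟨k, hk⟩ := Ideal.Quotient.mk_surjective ((a • y) m)
    refine ⟨k, ?_⟩
    rw [hz]
    congr 1
    funext m'
    by_cases hm : m' = m
    · subst hm; simp [hk]
    · rw [Pi.single_eq_of_ne hm]
      obtain ⟨l', hl', hlm⟩ : ∃ l' ∈ I, l' ∉ m'.asIdeal := by
        by_contra! hle
        exact hm (MaximalSpectrum.ext (hI.eq_of_le m'.isMaximal.ne_top hle).symm)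
      have hprod : (Ideal.Quotient.mk m'.asIdeal l') * (a • y) m' = 0 := congrFun (hkill l' hl') m'
      exact (mul_eq_zero.1 hprod).resolve_left fun h => hlm (Ideal.Quotient.eq_zero_iff_mem.1 h)
  refine isSimpleModule_iff_toSpanSingleton_surjective.2 ⟨hnt, fun φ hφ ψ => ?_⟩
  obtain ⟨k, hk⟩ := key φ
  obtain ⟨l, hl⟩ := key ψ
  have hkI : k ∉ I := fun h => hφ (by
    ext x
    obtain ⟨c, rfl⟩ := hs x
    have hk0 : Ideal.Quotient.mk m.asIdeal k = 0 := Ideal.Quotient.eq_zero_iff_mem.2 h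
    rw [hk0] at hk
    simp [hk])
  obtain ⟨a, b, hb, hab⟩ := hI.exists_inv hkI
  refine ⟨l * a, ?_⟩
  ext x
  obtain ⟨c, rfl⟩ := hs x
  have hq : (l * a) • Ideal.Quotient.mk m.asIdeal k = Ideal.Quotient.mk m.asIdeal l := by
    rw [Algebra.smul_def]
    change Ideal.Quotient.mk m.asIdeal (l * a) * _ = _
    rw [← map_mul, Ideal.Quotient.eq]
    have : l * a * k - l = - l * b := by linear_combination l * hab
    rw [this]
    exact m.asIdeal.mul_mem_left _ hb
  simp only [LinearMap.toSpanSingleton_apply, map_smul, LinearMap.smul_apply, SetLike.val_smul,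
    hk, hl]
  rw [← map_smul j (l * a), ← Pi.single_smul, hq]

lemma length_dual_le {E : Type u} [AddCommGroup E] [Module K E] (hE : Module.Injective K E)
    (hsimple : ∀ (S : Type u) [AddCommGroup S] [Module K S] [IsSimpleModule K S],
      Module.length K (S →ₗ[K] E) ≤ 1)
    {M : Type u} [AddCommGroup M] [Module K M] (hM : IsFiniteLength K M) :
    Module.length K (M →ₗ[K] E) ≤ Module.length K M := by
  induction hM with
  | @of_subsingleton M _ _ _ =>
    have : Subsingleton (M →ₗ[K] E) :=
      ⟨fun f g => LinearMap.ext fun x => by rw [Subsingleton.elim x 0, map_zero, map_zero]⟩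
    simp [Module.length_eq_zero]
  | @of_simple_quotient M _ _ N _ _ ih =>
    have h1 : Module.length K M = Module.length K N + 1 := by
      rw [Module.length_eq_add_of_exact N.subtype N.mkQ N.subtype_injective N.mkQ_surjective
        (LinearMap.exact_subtype_mkQ N), Module.length_eq_one K (M ⧸ N)]
    have h2 : Module.length K (M →ₗ[K] E) =
        Module.length K ((M ⧸ N) →ₗ[K] E) + Module.length K (N →ₗ[K] E) := by
      refine Module.length_eq_add_of_exact (LinearMap.lcomp K E N.mkQ)
        (LinearMap.lcomp K E N.subtype) ?_ ?_ ?_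
      · intro f g hfg
        ext x
        exact LinearMap.congr_fun hfg x
      · intro f
        obtain ⟨g, hg⟩ := hE.out N.subtype N.subtype_injective f
        exact ⟨g, LinearMap.ext hg⟩
      · intro f
        constructor
        · intro hf
          refine ⟨N.liftQ f fun x hx => LinearMap.congr_fun hf ⟨x, hx⟩, ?_⟩
          rfl
        · rintro ⟨g, rfl⟩
          ext x
          exact (congrArg g ((Submodule.Quotient.mk_eq_zero N).2 x.2)).trans (map_zero g)
    rw [h1, h2, add_comm]
    exact add_le_add ih (hsimple _)

lemma exists_functional_ne {E : Type u} [AddCommGroup E] [Module K E] (hE : Module.Injective K E)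
    (hm : ∀ I : Ideal K, I.IsMaximal → ∃ i : (K ⧸ I) →ₗ[K] E, i 1 ≠ 0)
    (M : Type u) [AddCommGroup M] [Module K M] (x : M) (hx : x ≠ 0) :
    ∃ φ : M →ₗ[K] E, φ x ≠ 0 := by
  obtain ⟨I, hI, hle⟩ := Ideal.exists_le_maximal (LinearMap.ker (LinearMap.toSpanSingleton K M x))
    (fun h => hx (by
      have : (1 : K) ∈ LinearMap.ker (LinearMap.toSpanSingleton K M x) := by rw [h]; trivial
      simpa using this))
  obtain ⟨i, hi⟩ := hm I hI
  obtain ⟨φ, hφ⟩ := hE.out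
    ((LinearMap.ker (LinearMap.toSpanSingleton K M x)).liftQ _ le_rfl)
    (LinearMap.ker_eq_bot.1 (Submodule.ker_liftQ_eq_bot _ _ _ le_rfl))
    (i ∘ₗ Submodule.factor hle)
  refine ⟨φ, ?_⟩
  have := hφ (Submodule.Quotient.mk 1)
  simp only [Submodule.liftQ_apply, LinearMap.toSpanSingleton_apply, one_smul] at this
  rw [this]
  exact hi

/-- A commutative artinian ring has a dualizing module, the injective hull of the sum of its
residue fields. -/
theorem exists_isDualizer (K : Type u) [CommRing K] [IsArtinianRing K] :
    ∃ (E : Type u) (_ : AddCommGroup E) (_ : Module K E), IsDualizer K E := by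
  classical
  obtain ⟨Q, _, _, j, hQ, hj⟩ :=
    exists_injective_embedding (K := K) (∀ m : MaximalSpectrum K, K ⧸ m.asIdeal)
  obtain ⟨N, hTN, hN, hmax⟩ := exists_maximal_essential (LinearMap.range j)
  have hE : Module.Injective K N := injective_of_maximal_essential hN hmax
  have hlen : ∀ {M : Type u} [AddCommGroup M] [Module K M], IsFiniteLength K M →
      Module.length K (M →ₗ[K] N) ≤ Module.length K M := fun hM =>
    length_dual_le hE (fun S _ _ _ => length_dual_simple_le j hj hN S) hM
  have hfl : ∀ {M : Type u} [AddCommGroup M] [Module K M], Module.Finite K M →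
      IsFiniteLength K M := fun h =>
    isFiniteLength_iff_isNoetherian_isArtinian.2 ⟨inferInstance, inferInstance⟩
  have hfin : ∀ (M : Type u) [AddCommGroup M] [Module K M], Module.Finite K M →
      IsFiniteLength K (M →ₗ[K] N) := fun M _ _ h =>
    Module.length_ne_top_iff.1
      (ne_top_of_le_ne_top (Module.length_ne_top_iff.2 (hfl h)) (hlen (hfl h)))
  have hne : ∀ (M : Type u) [AddCommGroup M] [Module K M] (x : M), x ≠ 0 →
      ∃ φ : M →ₗ[K] N, φ x ≠ 0 := by
    refine fun M _ _ x hx => exists_functional_ne hE (fun I hI => ?_) M x hx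
    let m : MaximalSpectrum K := ⟨I, hI⟩
    refine ⟨(j ∘ₗ LinearMap.single K _ m).codRestrict N fun y => hTN ⟨_, rfl⟩, fun h => ?_⟩
    have h0 : j (Pi.single m 1) = 0 := congrArg Subtype.val h
    have h1 := hj (h0.trans (map_zero j).symm)
    rw [Pi.single_eq_zero_iff] at h1
    have : Nontrivial (K ⧸ m.asIdeal) := Ideal.Quotient.nontrivial_iff.2 hI.ne_top
    exact one_ne_zero h1
  refine ⟨N, inferInstance, inferInstance, ?_, hE, hne, fun M _ _ hM Φ => ?_⟩
  · have := (isFiniteLength_iff_isNoetherian_isArtinian.1 (hfin K inferInstance)).1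
    exact Module.Finite.equiv (LinearMap.ringLmapEquivSelf K K N)
  · let ev : M →ₗ[K] (M →ₗ[K] N) →ₗ[K] N := LinearMap.flip LinearMap.id
    have hinj : Function.Injective ev := by
      rw [← LinearMap.ker_eq_bot, LinearMap.ker_eq_bot']
      intro x hx
      by_contra hx0
      obtain ⟨φ, hφ⟩ := hne M x hx0
      exact hφ (LinearMap.congr_fun hx φ)
    have h1 := hfin M hM
    obtain ⟨_, _⟩ := isFiniteLength_iff_isNoetherian_isArtinian.1 h1
    obtain ⟨_, _⟩ := isFiniteLength_iff_isNoetherian_isArtinian.1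
      (hfin (M →ₗ[K] N) inferInstance)
    have hrange : LinearMap.range ev = ⊤ := by
      by_contra hne'
      have h2 := Submodule.length_lt hne'
      rw [← (LinearEquiv.ofInjective ev hinj).length_eq] at h2
      exact absurd ((hlen h1).trans (hlen (hfl hM))) (not_le.2 h2)
    obtain ⟨x, hx⟩ := LinearMap.range_eq_top.1 hrange Φ
    exact ⟨x, fun φ => by rw [← hx]; rfl⟩

end Dualizer

section Functionals

variable {K : Type u} [CommRing K] {R : Type u} [Ring R] [Algebra K R]
  {E : Type u} [AddCommGroup E] [Module K E]

/-- The pairing `r ↦ (x ↦ ∑ i, l i (r i • x))`. -/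
def tupleFunctional {X : Type u} [AddCommGroup X] [Module R X] [Module K X] [IsScalarTower K R X]
    {n : ℕ} (l : Fin n → X →ₗ[K] E) : (Fin n → R) →ₗ[K] X →ₗ[K] E where
  toFun r := ∑ i, l i ∘ₗ (Algebra.lsmul K K X (r i))
  map_add' r s := by ext x; simp [Finset.sum_add_distrib]
  map_smul' k r := by ext x; simp [Finset.smul_sum]

lemma tupleFunctional_apply {X : Type u} [AddCommGroup X] [Module R X] [Module K X]
    [IsScalarTower K R X] {n : ℕ} (l : Fin n → X →ₗ[K] E) (r : Fin n → R) (x : X) :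
    tupleFunctional l r x = ∑ i, l i (r i • x) := by
  simp [tupleFunctional]

lemma tupleFunctional_surjective {X : Type u} [AddCommGroup X] [Module R X] [Module K X]
    [IsScalarTower K R X] {n : ℕ} {l : Fin n → X →ₗ[K] E}
    (hl : Submodule.span K (Set.range l) = ⊤) :
    Function.Surjective (tupleFunctional (R := R) l) := by
  classical
  rw [← LinearMap.range_eq_top, eq_top_iff, ← hl, Submodule.span_le]
  rintro _ ⟨i, rfl⟩
  refine ⟨Pi.single i 1, ?_⟩
  ext x
  rw [tupleFunctional_apply, Finset.sum_eq_single i]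
  · simp
  · intro j _ hj
    simp [Pi.single_eq_of_ne hj]
  · simp

lemma exists_factor_through_surjective {V W : Type u} [AddCommGroup V] [Module K V]
    [AddCommGroup W] [Module K W] {p : V →ₗ[K] W} (hp : Function.Surjective p) (q : V →ₗ[K] E)
    (hq : ∀ v, p v = 0 → q v = 0) : ∃ Φ : W →ₗ[K] E, ∀ v, Φ (p v) = q v := by
  refine ⟨(LinearMap.ker p).liftQ q hq ∘ₗ (p.quotKerEquivOfSurjective hp).symm.toLinearMap,
    fun v => ?_⟩
  have : (p.quotKerEquivOfSurjective hp).symm (p v) = Submodule.Quotient.mk v := by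
    rw [LinearEquiv.symm_apply_eq]; rfl
  rw [LinearMap.comp_apply, LinearEquiv.coe_coe, this]
  rfl

lemma exists_linearMap_of_functionals (hE : IsDualizer K E)
    {X Y : Type u} [AddCommGroup X] [Module R X] [Module K X] [IsScalarTower K R X]
    [AddCommGroup Y] [Module R Y] [Module K Y] [IsScalarTower K R Y] [Module.Finite K X]
    {n : ℕ} {l : Fin n → X →ₗ[K] E} (hl : Submodule.span K (Set.range l) = ⊤)
    (μ : Fin n → Y →ₗ[K] E)
    (hμ : ∀ r : Fin n → R, tupleFunctional l r = 0 → tupleFunctional μ r = 0) :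
    ∃ g : Y →ₗ[R] X, ∀ i y, l i (g y) = μ i y := by
  classical
  have hsurj := tupleFunctional_surjective (R := R) hl
  have hex : ∀ y : Y, ∃ x : X, ∀ r : Fin n → R, tupleFunctional l r x = tupleFunctional μ r y := by
    intro y
    obtain ⟨Φ, hΦ⟩ := exists_factor_through_surjective hsurj
      ((tupleFunctional (R := R) μ).flip y) fun r hr => by
        rw [LinearMap.flip_apply, hμ r hr, LinearMap.zero_apply]
    obtain ⟨x, hx⟩ := hE.reflexive X inferInstance Φ
    refine ⟨x, fun r => ?_⟩
    rw [← hx]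
    exact hΦ r
  have hsep : ∀ x x' : X, (∀ r : Fin n → R, tupleFunctional l r x = tupleFunctional l r x') →
      x = x' := by
    intro x x' h
    by_contra hne
    obtain ⟨φ, hφ⟩ := hE.exists_ne X (x - x') (sub_ne_zero.2 hne)
    obtain ⟨r, rfl⟩ := hsurj φ
    exact hφ (by rw [map_sub, h, sub_self])
  choose g hg using hex
  refine ⟨⟨⟨g, fun y y' => hsep _ _ fun r => ?_⟩, fun a y => hsep _ _ fun r => ?_⟩, fun i y => ?_⟩
  · rw [hg, map_add, map_add, hg, hg]
  · have h1 := hg y (fun i => r i * a)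
    simp only [tupleFunctional_apply, mul_smul] at h1
    rw [hg, RingHom.id_apply, tupleFunctional_apply, tupleFunctional_apply]
    exact h1.symm
  · have h1 := hg y (Pi.single i 1)
    simp only [tupleFunctional_apply] at h1
    rw [Finset.sum_eq_single i, Finset.sum_eq_single i] at h1
    · simpa using h1
    all_goals simp +contextual [Pi.single_eq_of_ne]

/-- The maps out of `X` that are killed by a functional on the endomorphisms are
described by a system of linear equations. -/
theorem exists_linear_system (hE : IsDualizer K E) [IsArtinianRing K] [Module.Finite K R]
    {X : Type u} [AddCommGroup X] [Module R X] [Module K X] [IsScalarTower K R X]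
    [Module.Finite K X] (φ : (X →ₗ[R] X) →ₗ[K] E) :
    ∃ (n m : ℕ) (x : Fin n → X) (a : Fin n → Fin m → R),
      ∀ (Y : Type u) [AddCommGroup Y] [Module R Y] [Module K Y] [IsScalarTower K R Y]
        (f : X →ₗ[R] Y),
        (∀ g : Y →ₗ[R] X, φ (g ∘ₗ f) = 0) ↔
          ∃ y : Fin m → Y, ∀ i, f (x i) = ∑ j, a i j • y j := by
  classical
  have hEfin := hE.finite
  obtain ⟨n, l, hl⟩ := Module.Finite.exists_fin (R := K) (M := X →ₗ[K] E)
  obtain ⟨m, b, hb⟩ := Module.Finite.exists_fin (R := K)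
    (M := LinearMap.ker (tupleFunctional (R := R) l))
  let res : (X →ₗ[R] X) →ₗ[K] Fin n → X →ₗ[K] E :=
    { toFun := fun f i => l i ∘ₗ f.restrictScalars K
      map_add' := fun f g => by ext; simp
      map_smul' := fun k f => by ext; simp }
  have hres : Function.Injective res := by
    rw [← LinearMap.ker_eq_bot, LinearMap.ker_eq_bot']
    intro f hf
    ext x
    by_contra hne
    obtain ⟨ψ, hψ⟩ := hE.exists_ne X (f x) hne
    obtain ⟨r, rfl⟩ := tupleFunctional_surjective (R := R) hl ψ
    refine hψ ?_
    rw [tupleFunctional_apply]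
    refine Finset.sum_eq_zero fun i _ => ?_
    rw [← map_smul f]
    exact LinearMap.congr_fun (congrFun hf i) _
  obtain ⟨Φ, hΦ⟩ := hE.injective.out res hres φ
  have hx : ∀ i, ∃ x : X, ∀ ψ : X →ₗ[K] E, Φ (Pi.single i ψ) = ψ x := fun i => by
    obtain ⟨x, hx⟩ := hE.reflexive X inferInstance (Φ ∘ₗ LinearMap.single K (fun _ => X →ₗ[K] E) i)
    exact ⟨x, hx⟩
  choose x hx using hx
  have hφ : ∀ f : X →ₗ[R] X, φ f = ∑ i, l i (f (x i)) := by
    intro f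
    rw [← hΦ, ← Finset.univ_sum_single (res f), map_sum]
    exact Finset.sum_congr rfl fun i _ => hx i _
  refine ⟨n, m, x, fun i j => (b j : Fin n → R) i, fun Y _ _ _ _ f => ⟨fun h => ?_, ?_⟩⟩
  · let W : Submodule K (Fin n → Y) := LinearMap.range
      ({ toFun := fun y i => ∑ j, (b j : Fin n → R) i • y j
         map_add' := fun y z => by ext; simp [Finset.sum_add_distrib]
         map_smul' := fun k y => by ext; simp [Finset.smul_sum, smul_comm k] } :
        (Fin m → Y) →ₗ[K] (Fin n → Y))
    suffices hW : (fun i => f (x i)) ∈ W by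
      obtain ⟨y, hy⟩ := hW
      exact ⟨y, fun i => (congrFun hy i).symm⟩
    by_contra hW
    obtain ⟨ψ, hψ⟩ := hE.exists_ne ((Fin n → Y) ⧸ W) (Submodule.Quotient.mk fun i => f (x i))
      (fun h0 => hW ((Submodule.Quotient.mk_eq_zero W).1 h0))
    let μ : Fin n → Y →ₗ[K] E := fun i => ψ ∘ₗ W.mkQ ∘ₗ LinearMap.single K (fun _ => Y) i
    have hμ' : ∀ z : Fin n → Y, ∑ i, μ i (z i) = ψ (W.mkQ z) := fun z => by
      conv_rhs => rw [← Finset.univ_sum_single z, map_sum, map_sum]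
      rfl
    have hμ : LinearMap.ker (tupleFunctional (R := R) l) ≤
        LinearMap.ker (tupleFunctional (R := R) μ) := by
      have h1 : (⊤ : Submodule K (LinearMap.ker (tupleFunctional (R := R) l))) ≤
          (LinearMap.ker (tupleFunctional (R := R) μ)).comap (Submodule.subtype _) := by
        rw [← hb, Submodule.span_le]
        rintro _ ⟨j, rfl⟩
        refine LinearMap.ext fun y => ?_
        rw [tupleFunctional_apply, LinearMap.zero_apply]
        refine (hμ' fun i => (b j : Fin n → R) i • y).trans ?_
        have : W.mkQ (fun i => (b j : Fin n → R) i • y) = 0 := by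
          refine (Submodule.Quotient.mk_eq_zero W).2 ⟨Pi.single j y, ?_⟩
          funext i
          change ∑ j', (b j' : Fin n → R) i • (Pi.single j y : Fin m → Y) j' = _
          rw [Finset.sum_eq_single j]
          · rw [Pi.single_eq_same]
          · intro j' _ hj
            rw [Pi.single_eq_of_ne hj, smul_zero]
          · simp
        rw [this, map_zero]
      exact fun r hr => h1 (x := ⟨r, hr⟩) trivial
    obtain ⟨g, hg⟩ := exists_linearMap_of_functionals (R := R) hE hl μ fun r hr => hμ hr
    refine hψ ?_
    rw [← h g, hφ]
    simp only [LinearMap.comp_apply, hg]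
    exact (hμ' fun i => f (x i)).symm
  · rintro ⟨y, hy⟩ g
    rw [hφ]
    simp only [LinearMap.comp_apply, hy, map_sum, map_smul]
    rw [Finset.sum_comm]
    refine Finset.sum_eq_zero fun j _ => ?_
    rw [← tupleFunctional_apply, LinearMap.mem_ker.1 (b j).2, LinearMap.zero_apply]

end Functionals

section Indecomposable

lemma Indec.eq_bot_or_eq_bot {M : Modc A} (hM : Indec M) {p q : Submodule Aᵐᵒᵖ M}
    (h : IsCompl p q) : p = ⊥ ∨ q = ⊥ := by
  rcases hM.2 (p.projection q h) (Submodule.isIdempotentElem_projection h) with h0 | h1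
  · left
    rw [← Submodule.range_projection h, h0, LinearMap.range_zero]
  · right
    rw [← Submodule.ker_projection h, h1, LinearMap.ker_id]

/-- If an isomorphism `L → L` factors through the indecomposable module `M`, the first factor is
an isomorphism. -/
lemma Indec.bijective_of_comp_bijective {M L : Modc A} (hM : Indec M) [Nontrivial L]
    {g : L →ₗ[Aᵐᵒᵖ] M} {k : M →ₗ[Aᵐᵒᵖ] L}
    (hk : Function.Bijective (k ∘ₗ g)) : Function.Bijective g := by
  let e := LinearEquiv.ofBijective _ hk
  have he : ∀ x, e.symm (k (g x)) = x := fun x => e.symm_apply_apply x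
  have hinj : Function.Injective g := fun x y hxy => by rw [← he x, ← he y, hxy]
  let π : M →ₗ[Aᵐᵒᵖ] M := g ∘ₗ e.symm.toLinearMap ∘ₗ k
  have hπ : π ∘ₗ π = π := by
    ext x
    simp [π, he]
  rcases hM.2 π hπ with h0 | h1
  · obtain ⟨x, hx⟩ := exists_ne (0 : L)
    refine absurd (hinj ?_ : x = 0) hx
    have h2 : π (g x) = g x := by simp [π, he]
    rw [← h2, h0, LinearMap.zero_apply, map_zero]
  · exact ⟨hinj, fun y => ⟨e.symm (k y), LinearMap.congr_fun h1 y⟩⟩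

lemma Indec.isNilpotent {M : Modc A} [IsArtinian Aᵐᵒᵖ M] [IsNoetherian Aᵐᵒᵖ M] (hM : Indec M)
    {f : Module.End Aᵐᵒᵖ M} (hf : ¬ Function.Bijective f) : IsNilpotent f := by
  obtain ⟨n, hn, hn1⟩ :=
    (f.eventually_isCompl_ker_pow_range_pow.and (Filter.eventually_ge_atTop 1)).exists
  rcases hM.eq_bot_or_eq_bot hn with h | h
  · refine absurd (IsArtinian.bijective_of_injective_endomorphism f fun x y hxy => ?_) hf
    refine LinearMap.ker_eq_bot.1 h ?_
    obtain ⟨m, rfl⟩ := Nat.exists_eq_add_of_le' hn1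
    rw [pow_succ, Module.End.mul_apply, Module.End.mul_apply, hxy]
  · exact ⟨n, LinearMap.range_eq_bot.1 h⟩

lemma Indec.not_bijective_add {M : Modc A} [IsArtinian Aᵐᵒᵖ M] [IsNoetherian Aᵐᵒᵖ M]
    (hM : Indec M) {f g : Module.End Aᵐᵒᵖ M} (hf : ¬ Function.Bijective f)
    (hg : ¬ Function.Bijective g) : ¬ Function.Bijective (f + g) := by
  intro h
  obtain ⟨u, hu⟩ := (Module.End.isUnit_iff _).2 h
  rw [← Module.End.isUnit_iff] at hf hg
  have hf' : ¬ IsUnit ((↑u⁻¹ : Module.End Aᵐᵒᵖ M) * f) := by rwa [Units.isUnit_units_mul]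
  have hg' : ¬ IsUnit ((↑u⁻¹ : Module.End Aᵐᵒᵖ M) * g) := by rwa [Units.isUnit_units_mul]
  rw [Module.End.isUnit_iff] at hf'
  refine hg' ?_
  have h1 : (↑u⁻¹ : Module.End Aᵐᵒᵖ M) * g = 1 - ↑u⁻¹ * f := by
    rw [eq_sub_iff_add_eq, ← mul_add, add_comm, ← hu, Units.inv_mul]
  rw [h1]
  exact (hM.isNilpotent hf').isUnit_one_sub

end Indecomposable

section Decomposition

/-- `M` is built from finitely many finitely generated indecomposable modules: the identity of
`M` is a finite sum of maps factoring through them. -/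
def HasDecomposition (M : Modc A) : Prop :=
  ∃ (ι : Type) (_ : Fintype ι) (X : ι → Modc A) (i : ∀ a, X a →ₗ[Aᵐᵒᵖ] M)
    (p : ∀ a, M →ₗ[Aᵐᵒᵖ] X a), (∀ a, FinGen (X a) ∧ Indec (X a)) ∧ ∀ x, ∑ a, i a (p a x) = x

lemma HasDecomposition.of_two {M M₁ M₂ : Modc A} (h₁ : HasDecomposition M₁)
    (h₂ : HasDecomposition M₂) (i₁ : M₁ →ₗ[Aᵐᵒᵖ] M) (p₁ : M →ₗ[Aᵐᵒᵖ] M₁)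
    (i₂ : M₂ →ₗ[Aᵐᵒᵖ] M) (p₂ : M →ₗ[Aᵐᵒᵖ] M₂) (h : ∀ x, i₁ (p₁ x) + i₂ (p₂ x) = x) :
    HasDecomposition M := by
  obtain ⟨ι, _, X, i, p, hX, hip⟩ := h₁
  obtain ⟨κ, _, Y, j, q, hY, hjq⟩ := h₂
  refine ⟨ι ⊕ κ, inferInstance, Sum.elim X Y,
    fun a => match a with
      | .inl a => i₁ ∘ₗ i a
      | .inr a => i₂ ∘ₗ j a,
    fun a => match a with
      | .inl a => p a ∘ₗ p₁
      | .inr a => q a ∘ₗ p₂, ?_, fun x => ?_⟩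
  · rintro (a | a)
    · exact hX a
    · exact hY a
  · rw [Fintype.sum_sum_type]
    refine Eq.trans (congrArg₂ (· + ·) ?_ ?_) (h x)
    · exact (map_sum i₁ (fun a => i a (p a (p₁ x))) _).symm.trans (congrArg i₁ (hip _))
    · exact (map_sum i₂ (fun a => j a (q a (p₂ x))) _).symm.trans (congrArg i₂ (hjq _))

theorem hasDecomposition [IsArtinianRing Aᵐᵒᵖ] (M : Modc A) (hM : FinGen M) :
    HasDecomposition M := by
  have main : ∀ (n : ℕ) (M : Modc A), FinGen M → Module.length Aᵐᵒᵖ M < n →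
      HasDecomposition M := by
    intro n
    induction n with
    | zero => intro M _ h; simp at h
    | succ n ih =>
      intro M hM hlen
      have : Module.Finite Aᵐᵒᵖ M := hM
      by_cases hI : Indec M
      · exact ⟨Unit, inferInstance, fun _ => M, fun _ => LinearMap.id, fun _ => LinearMap.id,
          fun _ => ⟨hM, hI⟩, fun x => by simp⟩
      rcases subsingleton_or_nontrivial M with hs | hnt
      · exact ⟨Empty, inferInstance, fun _ => M, fun _ => LinearMap.id, fun _ => LinearMap.id,
          fun a => a.elim, fun x => Subsingleton.elim _ _⟩
      obtain ⟨e, he, he0, he1⟩ : ∃ e : M →ₗ[Aᵐᵒᵖ] M, e ∘ₗ e = e ∧ e ≠ 0 ∧ e ≠ LinearMap.id := by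
        by_contra! hcon
        exact hI ⟨hnt, fun e he => or_iff_not_imp_left.2 (hcon e he)⟩
      have hee : ∀ x, e (e x) = e x := fun x => LinearMap.congr_fun he x
      have key : ∀ N : Submodule Aᵐᵒᵖ M, N ≠ ⊤ → HasDecomposition (ModuleCat.of Aᵐᵒᵖ N) := by
        intro N hN
        refine ih _ (inferInstanceAs (Module.Finite Aᵐᵒᵖ N)) ?_
        have h1 : Module.length Aᵐᵒᵖ N < Module.length Aᵐᵒᵖ M := Submodule.length_lt hN
        have h2 : Module.length Aᵐᵒᵖ M ≤ n := by
          rw [Nat.cast_succ] at hlen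
          exact Order.le_of_lt_add_one hlen
        exact h1.trans_le h2
      refine HasDecomposition.of_two (key (LinearMap.range e) fun h => he1 ?_)
        (key (LinearMap.ker e) fun h => he0 (LinearMap.ker_eq_top.1 h))
        (Submodule.subtype _) e.rangeRestrict
        (Submodule.subtype _) ((LinearMap.id - e).codRestrict _ fun x => by simp [hee]) fun x => ?_
      · ext x
        obtain ⟨y, rfl⟩ := LinearMap.range_eq_top.1 h x
        exact hee y
      · change e x + (x - e x) = x
        abel
  have : Module.Finite Aᵐᵒᵖ M := hM
  obtain ⟨n, hn⟩ := ENat.ne_top_iff_exists.1 (Module.length_ne_top (R := Aᵐᵒᵖ) (M := M))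
  refine main (n + 1) M hM ?_
  rw [← hn]
  exact_mod_cast Nat.lt_succ_self n

end Decomposition

section RadicalIdeal

lemma isNonIsoGen_of_not_bijective {X Y : Modc A} (hX : FinGen X) (hX' : Indec X)
    (hY : FinGen Y) (hY' : Indec Y) {f : X →ₗ[Aᵐᵒᵖ] Y} (hf : ¬ Function.Bijective f) :
    IsNonIsoGen f :=
  ⟨X, Y, f, LinearMap.id, LinearMap.id, hX, hX', hY, hY', hf, rfl⟩

lemma closure_comp_left {X Y Z : Modc A} {S : Set (X →ₗ[Aᵐᵒᵖ] Y)}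
    {T : AddSubgroup (X →ₗ[Aᵐᵒᵖ] Z)} {h : Y →ₗ[Aᵐᵒᵖ] Z} (hS : ∀ f ∈ S, h ∘ₗ f ∈ T)
    {f : X →ₗ[Aᵐᵒᵖ] Y} (hf : f ∈ AddSubgroup.closure S) : h ∘ₗ f ∈ T := by
  induction hf using AddSubgroup.closure_induction with
  | mem f hf => exact hS f hf
  | zero => rw [LinearMap.comp_zero]; exact T.zero_mem
  | add f g _ _ hf hg => rw [LinearMap.comp_add]; exact T.add_mem hf hg
  | neg f _ hf => rw [LinearMap.comp_neg]; exact T.neg_mem hf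

lemma closure_comp_right {X Y Z : Modc A} {S : Set (Y →ₗ[Aᵐᵒᵖ] Z)}
    {T : AddSubgroup (X →ₗ[Aᵐᵒᵖ] Z)} {g : X →ₗ[Aᵐᵒᵖ] Y} (hS : ∀ f ∈ S, f ∘ₗ g ∈ T)
    {f : Y →ₗ[Aᵐᵒᵖ] Z} (hf : f ∈ AddSubgroup.closure S) : f ∘ₗ g ∈ T := by
  induction hf using AddSubgroup.closure_induction with
  | mem f hf => exact hS f hf
  | zero => rw [LinearMap.zero_comp]; exact T.zero_mem
  | add f g _ _ hf hg => rw [LinearMap.add_comp]; exact T.add_mem hf hg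
  | neg f _ hf => rw [LinearMap.neg_comp]; exact T.neg_mem hf

lemma comp_mem_rad1_left {X Y Z : Modc A} (h : Y →ₗ[Aᵐᵒᵖ] Z) {f : X →ₗ[Aᵐᵒᵖ] Y}
    (hf : f ∈ rad1 X Y) : h ∘ₗ f ∈ rad1 X Z := by
  refine closure_comp_left ?_ hf
  rintro _ ⟨M, N, u, g, k, hM, hM', hN, hN', hu, rfl⟩
  exact AddSubgroup.subset_closure ⟨M, N, u, g, h ∘ₗ k, hM, hM', hN, hN', hu, rfl⟩

lemma comp_mem_rad1_right {X Y Z : Modc A} (g : X →ₗ[Aᵐᵒᵖ] Y) {f : Y →ₗ[Aᵐᵒᵖ] Z}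
    (hf : f ∈ rad1 Y Z) : f ∘ₗ g ∈ rad1 X Z := by
  refine closure_comp_right ?_ hf
  rintro _ ⟨M, N, u, g', k, hM, hM', hN, hN', hu, rfl⟩
  exact AddSubgroup.subset_closure ⟨M, N, u, g' ∘ₗ g, k, hM, hM', hN, hN', hu, rfl⟩

lemma comp_mem_radPow_left {n : ℕ} {X Y Z : Modc A} (h : Y →ₗ[Aᵐᵒᵖ] Z) {f : X →ₗ[Aᵐᵒᵖ] Y}
    (hf : f ∈ radPow n X Y) : h ∘ₗ f ∈ radPow n X Z := by
  cases n with
  | zero => exact comp_mem_rad1_left h hf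
  | succ n =>
    refine closure_comp_left ?_ hf
    rintro _ ⟨W, g, k, hW, hg, hk, rfl⟩
    exact AddSubgroup.subset_closure ⟨W, g, h ∘ₗ k, hW, hg, comp_mem_rad1_left h hk, rfl⟩

lemma comp_mem_radPow_right {n : ℕ} {X Y Z : Modc A} (g : X →ₗ[Aᵐᵒᵖ] Y) {f : Y →ₗ[Aᵐᵒᵖ] Z}
    (hf : f ∈ radPow n Y Z) : f ∘ₗ g ∈ radPow n X Z := by
  induction n generalizing X Y Z with
  | zero => exact comp_mem_rad1_right g hf
  | succ n ih =>
    refine closure_comp_right ?_ hf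
    rintro _ ⟨W, g', k, hW, hg', hk, rfl⟩
    exact AddSubgroup.subset_closure ⟨W, g' ∘ₗ g, k, hW, ih g hg', hk, rfl⟩

lemma radPow_succ_le (n : ℕ) (X Y : Modc A) : radPow (n + 1) X Y ≤ radPow n X Y := by
  refine (AddSubgroup.closure_le _).2 ?_
  rintro _ ⟨W, g, k, _, hg, _, rfl⟩
  exact comp_mem_radPow_left k hg

lemma radPow_antitone (X Y : Modc A) : Antitone fun n => radPow n X Y :=
  antitone_nat_of_succ_le fun n => radPow_succ_le n X Y

end RadicalIdeal

section AlmostSplit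

lemma mem_rad1_of_forall [IsArtinianRing Aᵐᵒᵖ] {X Y : Modc A} (hX : FinGen X) (hX' : Indec X)
    (hY : FinGen Y) {f : X →ₗ[Aᵐᵒᵖ] Y}
    (hf : ∀ g : Y →ₗ[Aᵐᵒᵖ] X, ¬ Function.Bijective (g ∘ₗ f)) : f ∈ rad1 X Y := by
  obtain ⟨ι, _, Z, i, p, hZ, hip⟩ := hasDecomposition Y hY
  have hsum : f = ∑ a, i a ∘ₗ (p a ∘ₗ f) := by
    ext x
    simp [hip]
  rw [hsum]
  refine AddSubgroup.sum_mem _ fun a _ => comp_mem_rad1_left _ (AddSubgroup.subset_closure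
    (isNonIsoGen_of_not_bijective hX hX' (hZ a).1 (hZ a).2 fun hb => ?_))
  let e := LinearEquiv.ofBijective _ hb
  refine hf (e.symm.toLinearMap ∘ₗ p a) ?_
  have : (e.symm.toLinearMap ∘ₗ p a) ∘ₗ f = LinearMap.id := by
    ext x
    exact e.symm_apply_apply x
  rw [this]
  exact Function.bijective_id

/-- A functional on a local endomorphism ring which vanishes on the maximal ideal and not at the
identity. -/
lemma exists_functional_on_end {K : Type u} [CommRing K] [Algebra K A] {E : Type u}
    [AddCommGroup E] [Module K E] (hE : IsDualizer K E) {X : Modc A} [Module K X]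
    [IsScalarTower K Aᵐᵒᵖ X] [IsArtinian Aᵐᵒᵖ X] [IsNoetherian Aᵐᵒᵖ X] (hX : Indec X) :
    ∃ φ : (X →ₗ[Aᵐᵒᵖ] X) →ₗ[K] E,
      φ LinearMap.id ≠ 0 ∧ ∀ f : X →ₗ[Aᵐᵒᵖ] X, ¬ Function.Bijective f → φ f = 0 := by
  have := hX.1
  let J : Submodule K (X →ₗ[Aᵐᵒᵖ] X) :=
    { carrier := {f | ¬ Function.Bijective f}
      add_mem' := fun hf hg => hX.not_bijective_add hf hg
      zero_mem' := fun h => by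
        obtain ⟨x, hx⟩ := exists_ne (0 : X)
        exact hx (h.1 rfl)
      smul_mem' := fun k f hf h => hf (IsArtinian.bijective_of_injective_endomorphism f
        fun x y hxy => h.1 (by simp [hxy])) }
  obtain ⟨ψ, hψ⟩ := hE.exists_ne ((X →ₗ[Aᵐᵒᵖ] X) ⧸ J) (Submodule.Quotient.mk LinearMap.id)
    fun h => (Submodule.Quotient.mk_eq_zero J).1 h Function.bijective_id
  refine ⟨ψ ∘ₗ J.mkQ, hψ, fun f hf => ?_⟩
  rw [LinearMap.comp_apply, Submodule.mkQ_apply, (Submodule.Quotient.mk_eq_zero J).2 hf, map_zero]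

/-- Universal solution of a linear system. -/
lemma exists_universal_solution {R : Type u} [Ring R] {X : Type u} [AddCommGroup X] [Module R X]
    [Module.Finite R X] {n m : ℕ} (x : Fin n → X) (a : Fin n → Fin m → R) :
    ∃ (U : Type u) (_ : AddCommGroup U) (_ : Module R U) (u : X →ₗ[R] U) (z : Fin m → U),
      Module.Finite R U ∧ (∀ i, u (x i) = ∑ j, a i j • z j) ∧
      ∀ (Y : Type u) [AddCommGroup Y] [Module R Y] (f : X →ₗ[R] Y) (y : Fin m → Y),
        (∀ i, f (x i) = ∑ j, a i j • y j) → ∃ g : U →ₗ[R] Y, g ∘ₗ u = f := by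
  classical
  let S : Submodule R (X × (Fin m → R)) := Submodule.span R (Set.range fun i => (x i, -a i))
  refine ⟨(X × (Fin m → R)) ⧸ S, inferInstance, inferInstance, S.mkQ ∘ₗ LinearMap.inl R X _,
    fun j => S.mkQ (0, Pi.single j 1), inferInstance, fun i => ?_, fun Y _ _ f y hy => ?_⟩
  · simp only [← map_smul, ← map_sum, LinearMap.comp_apply, LinearMap.inl_apply]
    refine (Submodule.Quotient.eq S).2 (Submodule.subset_span ⟨i, ?_⟩)
    refine Prod.ext ?_ ?_
    · simp [Prod.fst_sum]
    · simp only [Prod.snd_sub, Prod.snd_sum, Prod.smul_snd, zero_sub]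
      congr 1
      funext j
      simp [Finset.sum_apply, Pi.single_apply]
  · let F : X × (Fin m → R) →ₗ[R] Y := f.coprod (∑ j, (LinearMap.toSpanSingleton R Y (y j)) ∘ₗ
      LinearMap.proj j)
    refine ⟨S.liftQ F (Submodule.span_le.2 ?_), ?_⟩
    · rintro _ ⟨i, rfl⟩
      simp [F, hy]
    · ext v
      simp [F]

theorem exists_leftAlmostSplit (K : Type u) [CommRing K] [IsArtinianRing K] [Algebra K A]
    [Module.Finite K A] [IsArtinianRing Aᵐᵒᵖ] (X : Modc A) (hX : FinGen X) (hX' : Indec X) :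
    ∃ (U : Modc A) (u : X →ₗ[Aᵐᵒᵖ] U), FinGen U ∧ u ∈ rad1 X U ∧
      ∀ Y : Modc A, Indec Y → ∀ f : X →ₗ[Aᵐᵒᵖ] Y, ¬ Function.Bijective f →
        ∃ g : U →ₗ[Aᵐᵒᵖ] Y, g ∘ₗ u = f := by
  obtain ⟨E, _, _, hE⟩ := exists_isDualizer K
  have : Module.Finite Aᵐᵒᵖ X := hX
  have := hX'.1
  let _ : Module K X := Module.restrictScalars K Aᵐᵒᵖ X
  have : IsScalarTower K Aᵐᵒᵖ X := IsScalarTower.restrictScalars K Aᵐᵒᵖ X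
  have : Module.Finite K X := Module.Finite.trans Aᵐᵒᵖ X
  obtain ⟨φ, hφ1, hφ⟩ := exists_functional_on_end hE hX'
  obtain ⟨n, m, x, a, h⟩ := exists_linear_system hE φ
  obtain ⟨U, _, _, u, z, hU, huz, huniv⟩ := exists_universal_solution x a
  refine ⟨ModuleCat.of Aᵐᵒᵖ U, u, hU,
    mem_rad1_of_forall (Y := ModuleCat.of Aᵐᵒᵖ U) hX hX' hU fun g hg => ?_,
    fun Y hY f hf => ?_⟩
  · let _ : Module K U := Module.restrictScalars K Aᵐᵒᵖ U
    have : IsScalarTower K Aᵐᵒᵖ U := IsScalarTower.restrictScalars K Aᵐᵒᵖ U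
    let e := LinearEquiv.ofBijective _ hg
    refine hφ1 ?_
    have h1 := (h U u).2 ⟨z, huz⟩ (e.symm.toLinearMap ∘ₗ g)
    have h2 : (e.symm.toLinearMap ∘ₗ g) ∘ₗ u = LinearMap.id := by
      ext y
      exact e.symm_apply_apply y
    rwa [h2] at h1
  · let _ : Module K Y := Module.restrictScalars K Aᵐᵒᵖ Y
    have : IsScalarTower K Aᵐᵒᵖ Y := IsScalarTower.restrictScalars K Aᵐᵒᵖ Y
    obtain ⟨y, hy⟩ := (h Y f).1 fun g => hφ _ fun hb => hf (hY.bijective_of_comp_bijective hb)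
    exact huniv Y f y hy

end AlmostSplit

section Nilpotency

/-- The module of `K`-linear maps from `R` to `E`, with `R` acting through right multiplication
on the argument. -/
def Coinduced (K R E : Type u) [CommRing K] [Ring R] [Algebra K R] [AddCommGroup E] [Module K E] :
    Type u :=
  R →ₗ[K] E

variable {K R E : Type u} [CommRing K] [Ring R] [Algebra K R] [AddCommGroup E] [Module K E]

instance : AddCommGroup (Coinduced K R E) := inferInstanceAs (AddCommGroup (R →ₗ[K] E))

instance : Module K (Coinduced K R E) := inferInstanceAs (Module K (R →ₗ[K] E))

instance : Module R (Coinduced K R E) where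
  smul r l := LinearMap.comp (show R →ₗ[K] E from l) (LinearMap.mulRight K r)
  one_smul l := LinearMap.ext fun s => congrArg (show R →ₗ[K] E from l) (mul_one s)
  mul_smul r r' l := LinearMap.ext fun s =>
    congrArg (show R →ₗ[K] E from l) (mul_assoc s r r').symm
  smul_zero _ := LinearMap.ext fun _ => rfl
  smul_add _ _ _ := LinearMap.ext fun _ => rfl
  add_smul r r' l := LinearMap.ext fun s =>
    (congrArg (show R →ₗ[K] E from l) (mul_add s r r')).trans
      (map_add (show R →ₗ[K] E from l) _ _)
  zero_smul l := LinearMap.ext fun s =>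
    (congrArg (show R →ₗ[K] E from l) (mul_zero s)).trans (map_zero (show R →ₗ[K] E from l))

instance : IsScalarTower K R (Coinduced K R E) where
  smul_assoc k r l := LinearMap.ext fun s =>
    (congrArg (show R →ₗ[K] E from l) (mul_smul_comm k s r)).trans
      (map_smul (show R →ₗ[K] E from l) _ _)

lemma Coinduced.finite [IsArtinianRing K] [Module.Finite K R] [Module.Finite K E] :
    Module.Finite R (Coinduced K R E) := by
  have : Module.Finite K (Coinduced K R E) := inferInstanceAs (Module.Finite K (R →ₗ[K] E))
  exact Module.Finite.of_restrictScalars_finite K R _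

/-- The `R`-linear map to the coinduced module attached to a functional. -/
def Coinduced.lift {M : Type u} [AddCommGroup M] [Module R M] [Module K M] [IsScalarTower K R M]
    (l : M →ₗ[K] E) : M →ₗ[R] Coinduced K R E where
  toFun x := l ∘ₗ (LinearMap.toSpanSingleton R M x).restrictScalars K
  map_add' x y := LinearMap.ext fun s =>
    (congrArg l (smul_add s x y)).trans (map_add l _ _)
  map_smul' r x := LinearMap.ext fun s => congrArg l (mul_smul s r x).symm

lemma Coinduced.lift_ne_zero {M : Type u} [AddCommGroup M] [Module R M] [Module K M]
    [IsScalarTower K R M] {l : M →ₗ[K] E} {x : M} (h : l x ≠ 0) :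
    Coinduced.lift (R := R) l x ≠ 0 := fun h0 => h (by
  have h1 : l ((1 : R) • x) = 0 := LinearMap.congr_fun h0 (1 : R)
  rwa [one_smul] at h1)

/-- The elements of `M` whose associated map out of the regular module lies in a power of the
radical. -/
def radSubmodule (n : ℕ) (M : Modc A) : Submodule Aᵐᵒᵖ M where
  carrier := {x | LinearMap.toSpanSingleton Aᵐᵒᵖ M x ∈
    radPow n (ModuleCat.of Aᵐᵒᵖ Aᵐᵒᵖ) M}
  add_mem' {x y} hx hy := by
    have h : LinearMap.toSpanSingleton Aᵐᵒᵖ M (x + y) =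
        LinearMap.toSpanSingleton Aᵐᵒᵖ M x + LinearMap.toSpanSingleton Aᵐᵒᵖ M y := by
      ext; simp
    rw [Set.mem_ofPred_eq, h]
    exact AddSubgroup.add_mem _ hx hy
  zero_mem' := by
    have h : LinearMap.toSpanSingleton Aᵐᵒᵖ M 0 = 0 := by ext; simp
    rw [Set.mem_ofPred_eq, h]
    exact AddSubgroup.zero_mem _
  smul_mem' r x hx := by
    have h : LinearMap.toSpanSingleton Aᵐᵒᵖ M (r • x) =
        LinearMap.toSpanSingleton Aᵐᵒᵖ M x ∘ₗ LinearMap.toSpanSingleton Aᵐᵒᵖ Aᵐᵒᵖ r := by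
      ext; simp
    rw [Set.mem_ofPred_eq, h]
    exact comp_mem_radPow_right (X := ModuleCat.of Aᵐᵒᵖ Aᵐᵒᵖ) _ hx

lemma eq_toSpanSingleton {M : Modc A} (f : (ModuleCat.of Aᵐᵒᵖ Aᵐᵒᵖ : Modc A) →ₗ[Aᵐᵒᵖ] M) :
    LinearMap.toSpanSingleton Aᵐᵒᵖ M (f (1 : Aᵐᵒᵖ)) = f := by
  refine LinearMap.ext_ring ?_
  rw [LinearMap.toSpanSingleton_apply, one_smul]

theorem exists_radPow_eq_zero (K : Type u) [CommRing K] [IsArtinianRing K] [Algebra K A]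
    [Module.Finite K A] [IsArtinianRing Aᵐᵒᵖ]
    (hrad : ∀ X Y : Modc A, FinGen X → FinGen Y → radInf X Y = ⊥) :
    ∃ n, ∀ Y : Modc A, ∀ f ∈ radPow n (ModuleCat.of Aᵐᵒᵖ Aᵐᵒᵖ) Y, f = 0 := by
  obtain ⟨E, _, _, hE⟩ := exists_isDualizer K
  have := hE.finite
  let I : Modc A := ModuleCat.of Aᵐᵒᵖ (Coinduced K Aᵐᵒᵖ E)
  have hI : Module.Finite Aᵐᵒᵖ I := Coinduced.finite (K := K) (R := Aᵐᵒᵖ) (E := E)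
  obtain ⟨n, hn⟩ := IsArtinian.monotone_stabilizes
    (⟨fun n => OrderDual.toDual (radSubmodule n I),
      fun a b hab x hx => radPow_antitone _ _ hab hx⟩ : ℕ →o (Submodule Aᵐᵒᵖ I)ᵒᵈ)
  have hbot : ∀ f ∈ radPow n (ModuleCat.of Aᵐᵒᵖ Aᵐᵒᵖ) I, f = 0 := by
    intro f hf
    have h1 : f (1 : Aᵐᵒᵖ) ∈ radSubmodule n I := by
      change _ ∈ radPow n _ _
      rwa [eq_toSpanSingleton]
    have h2 : f ∈ radInf (ModuleCat.of Aᵐᵒᵖ Aᵐᵒᵖ) I := by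
      refine AddSubgroup.mem_iInf.2 fun k => ?_
      rcases le_total k n with hk | hk
      · exact radPow_antitone _ _ hk hf
      · have h3 : radSubmodule n I = radSubmodule k I := hn k hk
        rw [h3] at h1
        have h4 : LinearMap.toSpanSingleton Aᵐᵒᵖ I (f (1 : Aᵐᵒᵖ)) ∈
          radPow k (ModuleCat.of Aᵐᵒᵖ Aᵐᵒᵖ) I := h1
        rwa [eq_toSpanSingleton] at h4
    rw [hrad _ _ (inferInstanceAs (Module.Finite Aᵐᵒᵖ Aᵐᵒᵖ)) hI] at h2
    exact h2
  refine ⟨n, fun Y f hf => ?_⟩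
  by_contra hne
  have h1 : f (1 : Aᵐᵒᵖ) ≠ 0 := fun h0 => hne (by
    rw [← eq_toSpanSingleton f, h0]
    ext; simp)
  let _ : Module K Y := Module.restrictScalars K Aᵐᵒᵖ Y
  have : IsScalarTower K Aᵐᵒᵖ Y := IsScalarTower.restrictScalars K Aᵐᵒᵖ Y
  obtain ⟨l, hl⟩ := hE.exists_ne Y _ h1
  let F : Y →ₗ[Aᵐᵒᵖ] I := Coinduced.lift l
  have h2 : F ∘ₗ f = 0 := hbot _ (comp_mem_radPow_left F hf)
  exact Coinduced.lift_ne_zero (R := Aᵐᵒᵖ) hl (LinearMap.congr_fun h2 (1 : Aᵐᵒᵖ))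

end Nilpotency

section FiniteType

/-- Maps out of `T` into indecomposable modules outside a finite list factor through a single
radical map. -/
lemma exists_rad1_factor (K : Type u) [CommRing K] [IsArtinianRing K] [Algebra K A]
    [Module.Finite K A] [IsArtinianRing Aᵐᵒᵖ] (T : Modc A) (hT : FinGen T) :
    ∃ (T' : Modc A) (t : T →ₗ[Aᵐᵒᵖ] T') (ι : Type) (_ : Finite ι) (X : ι → Modc A),
      FinGen T' ∧ t ∈ rad1 T T' ∧ ∀ Y : Modc A, Indec Y → (∀ a, IsEmpty (X a ≃ₗ[Aᵐᵒᵖ] Y)) →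
        ∀ h : T →ₗ[Aᵐᵒᵖ] Y, ∃ h' : T' →ₗ[Aᵐᵒᵖ] Y, h = h' ∘ₗ t := by
  classical
  obtain ⟨ι, _, X, i, p, hX, hip⟩ := hasDecomposition T hT
  choose U u hU hu hfac using fun a => exists_leftAlmostSplit K (X a) (hX a).1 (hX a).2
  have (a : ι) : Module.Finite Aᵐᵒᵖ (U a) := hU a
  let T' : Modc A := ModuleCat.of Aᵐᵒᵖ (∀ a, U a)
  let t : T →ₗ[Aᵐᵒᵖ] T' := ∑ a, (LinearMap.single Aᵐᵒᵖ (fun a => U a) a) ∘ₗ (u a ∘ₗ p a)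
  refine ⟨T', t, ι, inferInstance, X, inferInstanceAs (Module.Finite Aᵐᵒᵖ (∀ a, U a)),
    AddSubgroup.sum_mem _ fun a _ => ?_, fun Y hY hne h => ?_⟩
  · exact comp_mem_rad1_left (Z := T') (LinearMap.single Aᵐᵒᵖ (fun a => U a) a)
      (comp_mem_rad1_right (p a) (hu a))
  · choose g hg using fun a => hfac a Y hY (h ∘ₗ i a) fun hb =>
      (hne a).false (LinearEquiv.ofBijective _ hb)
    refine ⟨∑ a, g a ∘ₗ LinearMap.proj a, LinearMap.ext fun x => ?_⟩
    have ht : ∀ b, t x b = u b (p b x) := fun b => by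
      simp only [t, LinearMap.sum_apply, LinearMap.comp_apply]
      rw [Finset.sum_apply]
      exact (Finset.sum_pi_single b (fun c => u c (p c x)) _).trans (if_pos (Finset.mem_univ b))
    calc h x = ∑ a, h (i a (p a x)) := by rw [← map_sum, hip]
      _ = ∑ a, g a (u a (p a x)) :=
        Finset.sum_congr rfl fun a _ => (LinearMap.congr_fun (hg a) (p a x)).symm
      _ = _ := by
        rw [LinearMap.comp_apply, LinearMap.sum_apply]
        refine Finset.sum_congr rfl fun a _ => ?_
        rw [← ht a]
        rfl

lemma exists_radPow_factor (K : Type u) [CommRing K] [IsArtinianRing K] [Algebra K A]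
    [Module.Finite K A] [IsArtinianRing Aᵐᵒᵖ] (T : Modc A) (hT : FinGen T) (n : ℕ) :
    ∃ (T' : Modc A) (t : T →ₗ[Aᵐᵒᵖ] T') (ι : Type) (_ : Finite ι) (X : ι → Modc A),
      FinGen T' ∧ t ∈ radPow n T T' ∧ ∀ Y : Modc A, Indec Y → (∀ a, IsEmpty (X a ≃ₗ[Aᵐᵒᵖ] Y)) →
        ∀ h : T →ₗ[Aᵐᵒᵖ] Y, ∃ h' : T' →ₗ[Aᵐᵒᵖ] Y, h = h' ∘ₗ t := by
  induction n with
  | zero => exact exists_rad1_factor K T hT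
  | succ n ih =>
    obtain ⟨T₁, t₁, ι, _, X, hT₁, ht₁, h₁⟩ := ih
    obtain ⟨T₂, t₂, κ, _, Z, hT₂, ht₂, h₂⟩ := exists_rad1_factor K T₁ hT₁
    refine ⟨T₂, t₂ ∘ₗ t₁, ι ⊕ κ, inferInstance, Sum.elim X Z, hT₂,
      AddSubgroup.subset_closure ⟨T₁, t₁, t₂, hT₁, ht₁, ht₂, rfl⟩, fun Y hY hne h => ?_⟩
    obtain ⟨h', rfl⟩ := h₁ Y hY (fun a => hne (Sum.inl a)) h
    obtain ⟨h'', rfl⟩ := h₂ Y hY (fun a => hne (Sum.inr a)) h'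
    exact ⟨h'', rfl⟩

theorem finite_type_of_radInf_eq_bot (K : Type u) [CommRing K] [IsArtinianRing K] [Algebra K A]
    [Module.Finite K A] (hrad : ∀ X Y : Modc A, FinGen X → FinGen Y → radInf X Y = ⊥) :
    ∃ (ι : Type u) (_ : Finite ι) (F : ι → Modc A),
      ∀ X : Modc A, FinGen X → Indec X → ∃ i, Nonempty (X ≃ₗ[Aᵐᵒᵖ] F i) := by
  have : IsArtinianRing Aᵐᵒᵖ := IsArtinianRing.of_finite K Aᵐᵒᵖ
  obtain ⟨n, hn⟩ := exists_radPow_eq_zero K hrad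
  obtain ⟨T, t, ι, _, X, -, ht, hfac⟩ := exists_radPow_factor K (ModuleCat.of Aᵐᵒᵖ Aᵐᵒᵖ : Modc A)
    (inferInstanceAs (Module.Finite Aᵐᵒᵖ Aᵐᵒᵖ)) n
  refine ⟨ULift.{u} ι, inferInstance, fun a => X a.down, fun Y _ hY => ?_⟩
  by_contra! hne
  obtain ⟨y, hy⟩ := @exists_ne _ hY.1 (0 : Y)
  obtain ⟨h', hh'⟩ := hfac Y hY
    (fun a => ⟨fun e => (hne ⟨a⟩).false e.symm⟩) (LinearMap.toSpanSingleton Aᵐᵒᵖ Y y)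
  have h0 := hn Y (h' ∘ₗ t) (comp_mem_radPow_left h' ht)
  rw [← hh'] at h0
  refine hy ?_
  rw [← LinearMap.toSpanSingleton_apply_one Aᵐᵒᵖ Y y, h0]
  rfl

end FiniteType

section HaradaSai

/-- A non-isomorphism between finitely generated indecomposable modules. -/
structure IsNonIso {M N : Modc A} (u : M →ₗ[Aᵐᵒᵖ] N) : Prop where
  source : FinGen M ∧ Indec M
  target : FinGen N ∧ Indec N
  not_bijective : ¬ Function.Bijective u

/-- `IsPath n M N p` says that `p : M → N` is a composition of `n + 1` non-isomorphisms between
finitely generated indecomposable modules. -/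
inductive IsPath : ℕ → (M N : Modc A) → (M →ₗ[Aᵐᵒᵖ] N) → Prop
  | single {M N : Modc A} {u : M →ₗ[Aᵐᵒᵖ] N} (hu : IsNonIso u) : IsPath 0 M N u
  | comp {n : ℕ} {M Z N : Modc A} {q : M →ₗ[Aᵐᵒᵖ] Z} {u : Z →ₗ[Aᵐᵒᵖ] N} (hq : IsPath n M Z q)
      (hu : IsNonIso u) : IsPath (n + 1) M N (u ∘ₗ q)

lemma IsPath.target {n : ℕ} {M N : Modc A} {p : M →ₗ[Aᵐᵒᵖ] N} (hp : IsPath n M N p) :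
    FinGen N ∧ Indec N := by
  cases hp with
  | single hu => exact hu.target
  | comp _ hu => exact hu.target

lemma IsPath.isNonIso {M N : Modc A} {p : M →ₗ[Aᵐᵒᵖ] N} (hp : IsPath 0 M N p) : IsNonIso p := by
  cases hp with
  | single hu => exact hu

/-- A path can be cut in two. -/
lemma IsPath.split {a c : ℕ} {M N : Modc A} {p : M →ₗ[Aᵐᵒᵖ] N} (hp : IsPath (a + c + 1) M N p) :
    ∃ (Z : Modc A) (f : M →ₗ[Aᵐᵒᵖ] Z) (g : Z →ₗ[Aᵐᵒᵖ] N),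
      IsPath a M Z f ∧ IsPath c Z N g ∧ p = g ∘ₗ f := by
  induction c generalizing N with
  | zero =>
    cases hp with
    | comp hq hu => exact ⟨_, _, _, hq, .single hu, rfl⟩
  | succ c ih =>
    cases hp with
    | comp hq hu =>
      obtain ⟨Z, f, g, hf, hg, rfl⟩ := ih hq
      exact ⟨Z, f, _, hf, .comp hg hu, rfl⟩

lemma length_range_comp_le {R X Y W : Type*} [Ring R] [AddCommGroup X] [AddCommGroup Y]
    [AddCommGroup W] [Module R X] [Module R Y] [Module R W] (f : X →ₗ[R] Y) (g : Y →ₗ[R] W) :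
    Module.length R (LinearMap.range (g ∘ₗ f)) ≤ Module.length R (LinearMap.range f) := by
  rw [LinearMap.range_comp]
  exact Module.length_le_of_surjective (g.submoduleMap (LinearMap.range f))
    (g.submoduleMap_surjective _)

lemma length_range_comp_le' {R X Y W : Type*} [Ring R] [AddCommGroup X] [AddCommGroup Y]
    [AddCommGroup W] [Module R X] [Module R Y] [Module R W] (f : X →ₗ[R] Y) (g : Y →ₗ[R] W) :
    Module.length R (LinearMap.range (g ∘ₗ f)) ≤ Module.length R (LinearMap.range g) :=
  Module.length_le_of_injective (Submodule.inclusion (LinearMap.range_comp_le_range f g))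
    (Submodule.inclusion_injective _)

lemma injective_of_surjective_of_length_le {R X Y : Type*} [Ring R] [AddCommGroup X]
    [AddCommGroup Y] [Module R X] [Module R Y] {f : X →ₗ[R] Y} (hf : Function.Surjective f)
    (h : Module.length R X ≤ Module.length R Y) (hY : Module.length R Y ≠ ⊤) :
    Function.Injective f := by
  have h1 := Module.length_eq_add_of_exact (LinearMap.ker f).subtype f
    (Submodule.subtype_injective _) hf f.exact_subtype_ker_map
  have h2 : Module.length R (LinearMap.ker f) ≤ 0 :=
    (ENat.add_le_add_iff_right hY).1 (by rwa [zero_add, ← h1])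
  rw [nonpos_iff_eq_zero, Module.length_eq_zero_iff, Submodule.subsingleton_iff_eq_bot] at h2
  exact LinearMap.ker_eq_bot.1 h2

lemma eq_of_le_of_length_le {R Y : Type*} [Ring R] [AddCommGroup Y] [Module R Y]
    {N P : Submodule R Y} (hNP : N ≤ P) (h : Module.length R P ≤ Module.length R N)
    (hN : Module.length R N ≠ ⊤) : N = P := by
  have h1 := Module.length_eq_add_of_exact (Submodule.inclusion hNP)
    (LinearMap.range (Submodule.inclusion hNP)).mkQ (Submodule.inclusion_injective hNP)
    (Submodule.mkQ_surjective _) (LinearMap.exact_map_mkQ_range _)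
  have h2 : Module.length R (P ⧸ LinearMap.range (Submodule.inclusion hNP)) ≤ 0 :=
    (ENat.add_le_add_iff_left hN).1 (by rwa [add_zero, ← h1])
  rw [nonpos_iff_eq_zero, Module.length_eq_zero_iff, Submodule.Quotient.subsingleton_iff,
    Submodule.range_inclusion, Submodule.comap_subtype_eq_top] at h2
  exact le_antisymm hNP h2

/-- Two maps whose ranges are not longer than the range of their composition split the middle
module. -/
lemma isCompl_range_ker {R X Y W : Type*} [Ring R] [AddCommGroup X] [AddCommGroup Y]
    [AddCommGroup W] [Module R X] [Module R Y] [Module R W] {f : X →ₗ[R] Y} {g : Y →ₗ[R] W}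
    (hgf : Module.length R (LinearMap.range (g ∘ₗ f)) ≠ ⊤)
    (hf : Module.length R (LinearMap.range f) ≤ Module.length R (LinearMap.range (g ∘ₗ f)))
    (hg : Module.length R (LinearMap.range g) ≤ Module.length R (LinearMap.range (g ∘ₗ f))) :
    IsCompl (LinearMap.range f) (LinearMap.ker g) := by
  have h1 := eq_of_le_of_length_le (LinearMap.range_comp_le_range f g) hg hgf
  rw [LinearMap.range_comp] at hf hgf
  have h2 := injective_of_surjective_of_length_le (g.submoduleMap_surjective _) hf hgf
  refine ⟨Submodule.disjoint_def.2 fun y hy hy' => ?_,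
    codisjoint_iff.2 (eq_top_iff.2 fun y _ => ?_)⟩
  · exact congrArg Subtype.val (h2 (a₁ := ⟨y, hy⟩) (a₂ := 0)
      (Subtype.ext ((LinearMap.mem_ker.1 hy').trans (map_zero g).symm)))
  · obtain ⟨x, hx⟩ : g y ∈ LinearMap.range (g ∘ₗ f) := h1 ▸ LinearMap.mem_range_self g y
    refine Submodule.mem_sup.2 ⟨f x, ⟨x, rfl⟩, y - f x, ?_, add_sub_cancel _ _⟩
    rw [LinearMap.mem_ker, map_sub, sub_eq_zero]
    exact hx.symm

/-- The Harada–Sai lemma. -/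
theorem exists_forall_isPath_eq_zero (b : ℕ)
    (hb : ∀ X : Modc A, FinGen X → Indec X → Module.length Aᵐᵒᵖ X ≤ b) :
    ∃ n, ∀ (M N : Modc A) (p : M →ₗ[Aᵐᵒᵖ] N), IsPath n M N p → p = 0 := by
  have main : ∀ j c : ℕ, c + j = b → ∃ n, ∀ (M N : Modc A) (p : M →ₗ[Aᵐᵒᵖ] N), IsPath n M N p →
      Module.length Aᵐᵒᵖ (LinearMap.range p) ≤ c := by
    intro j
    induction j with
    | zero =>
      rintro c rfl
      exact ⟨0, fun M N p hp => (Module.length_le_of_injective (LinearMap.range p).subtype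
        (Submodule.subtype_injective _)).trans (hb N hp.target.1 hp.target.2)⟩
    | succ j ih =>
      intro c hc
      obtain ⟨n, hn⟩ := ih (c + 1) (by omega)
      refine ⟨n + (0 + n + 1) + 1, fun M N p hp => ?_⟩
      obtain ⟨Y, f, q, hf, hq, rfl⟩ := hp.split
      obtain ⟨Z, u, h, hu, hh, rfl⟩ := hq.split
      replace hu := hu.isNonIso
      by_contra hlt
      rw [not_le] at hlt
      have hle : ((c + 1 : ℕ) : ℕ∞) ≤ Module.length Aᵐᵒᵖ (LinearMap.range ((h ∘ₗ u) ∘ₗ f)) := by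
        rw [Nat.cast_succ]
        exact Order.add_one_le_of_lt hlt
      have hf' := hn _ _ f hf
      have hh' := hn _ _ h hh
      have hpos : ¬ Module.length Aᵐᵒᵖ (LinearMap.range ((h ∘ₗ u) ∘ₗ f)) = 0 := fun h0 =>
        not_lt_zero (h0 ▸ hlt)
      have hfin : Module.length Aᵐᵒᵖ (LinearMap.range ((h ∘ₗ u) ∘ₗ f)) ≠ ⊤ :=
        ne_top_of_le_ne_top (ENat.natCast_ne_top (c + 1)) ((length_range_comp_le _ _).trans hf')
      have hY := isCompl_range_ker hfin (hf'.trans hle)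
        (((length_range_comp_le' u h).trans hh').trans hle)
      have hZ := isCompl_range_ker (f := u ∘ₗ f) (g := h) hfin
        (((length_range_comp_le f u).trans hf').trans hle) (hh'.trans hle)
      refine hu.not_bijective ⟨?_, ?_⟩
      · rcases hu.source.2.eq_bot_or_eq_bot hY with h0 | h0
        · refine absurd ?_ hpos
          rw [LinearMap.range_comp, h0, Submodule.map_bot, Module.length_bot]
        · exact Function.Injective.of_comp (f := h) (LinearMap.ker_eq_bot.1 h0)
      · rcases hu.target.2.eq_bot_or_eq_bot hZ with h0 | h0
        · refine absurd ?_ hpos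
          rw [LinearMap.comp_assoc, LinearMap.range_comp, h0, Submodule.map_bot, Module.length_bot]
        · have h1 := hZ.sup_eq_top
          rw [h0, sup_bot_eq] at h1
          exact Function.Surjective.of_comp (g := f) (LinearMap.range_eq_top.1 h1)
  obtain ⟨n, hn⟩ := main b 0 (zero_add b)
  refine ⟨n, fun M N p hp => ?_⟩
  have h := hn M N p hp
  rw [Nat.cast_zero, nonpos_iff_eq_zero, Module.length_eq_zero_iff,
    Submodule.subsingleton_iff_eq_bot] at h
  exact LinearMap.range_eq_bot.1 h

/-- Powers of the radical are generated by maps factoring through paths. -/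
lemma radPow_le_closure_isPath (n : ℕ) (X Y : Modc A) :
    radPow n X Y ≤ AddSubgroup.closure {f | ∃ (M N : Modc A) (p : M →ₗ[Aᵐᵒᵖ] N)
      (g : X →ₗ[Aᵐᵒᵖ] M) (h : N →ₗ[Aᵐᵒᵖ] Y), IsPath n M N p ∧ f = h ∘ₗ (p ∘ₗ g)} := by
  induction n generalizing Y with
  | zero =>
    refine AddSubgroup.closure_mono ?_
    rintro _ ⟨M, N, u, g, h, hM, hM', hN, hN', hu, rfl⟩
    exact ⟨M, N, u, g, h, .single ⟨⟨hM, hM'⟩, ⟨hN, hN'⟩, hu⟩, rfl⟩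
  | succ n ih =>
    refine (AddSubgroup.closure_le _).2 ?_
    rintro _ ⟨Z, f, k, -, hf, hk, rfl⟩
    refine closure_comp_left (fun f hf => ?_) (ih Z hf)
    obtain ⟨M, N, p, g, h, hp, rfl⟩ := hf
    refine closure_comp_right (fun k hk => ?_) hk
    obtain ⟨M', N', u, g', h', hM, hM', hN, hN', hu, rfl⟩ := hk
    refine AddSubgroup.subset_closure ⟨M, N', (u ∘ₗ (g' ∘ₗ h)) ∘ₗ p, g, h',
      .comp hp ⟨hp.target, ⟨hN, hN'⟩, fun hb => hu ?_⟩, rfl⟩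
    have := hp.target.2.1
    have hgh : Function.Bijective (g' ∘ₗ h) := by
      let e := LinearEquiv.ofBijective _ hb
      refine hM'.bijective_of_comp_bijective (k := e.symm.toLinearMap ∘ₗ u) ?_
      have h1 : (e.symm.toLinearMap ∘ₗ u) ∘ₗ (g' ∘ₗ h) = LinearMap.id :=
        LinearMap.ext fun x => e.symm_apply_apply x
      rw [h1]
      exact Function.bijective_id
    rw [LinearMap.coe_comp] at hb
    exact (Function.Bijective.of_comp_iff _ hgh).1 hb

theorem radInf_eq_bot_of_finite_type [IsArtinianRing Aᵐᵒᵖ] {ι : Type u} [Finite ι]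
    (F : ι → Modc A) (hF : ∀ X : Modc A, FinGen X → Indec X → ∃ i, Nonempty (X ≃ₗ[Aᵐᵒᵖ] F i))
    (X Y : Modc A) : radInf X Y = ⊥ := by
  obtain ⟨b, hb⟩ := (Set.finite_range fun i => (Module.length Aᵐᵒᵖ (F i)).toNat).bddAbove
  obtain ⟨n, hn⟩ := exists_forall_isPath_eq_zero b fun X hX hX' => by
    obtain ⟨i, ⟨e⟩⟩ := hF X hX hX'
    have : Module.Finite Aᵐᵒᵖ X := hX
    have h1 : Module.length Aᵐᵒᵖ (F i) ≠ ⊤ := e.length_eq ▸ Module.length_ne_top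
    rw [e.length_eq, ← ENat.natCast_toNat h1]
    exact_mod_cast hb ⟨i, rfl⟩
  refine eq_bot_iff.2 fun f hf => ?_
  have h1 := radPow_le_closure_isPath n X Y (AddSubgroup.mem_iInf.1 hf n)
  refine (AddSubgroup.closure_le ⊥).2 ?_ h1
  rintro _ ⟨M, N, p, g, h, hp, rfl⟩
  rw [hn M N p hp, LinearMap.zero_comp, LinearMap.comp_zero]
  exact AddSubgroup.zero_mem _

end HaradaSai

/-- For an artin algebra `A`, the infinite radical of `mod A`
vanishes if and only if `A` is of finite representation type. -/
theorem radInf_eq_bot_iff_finite_representation_type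
    (K : Type u) [CommRing K] [IsArtinianRing K]
    (A : Type u) [Ring A] [Algebra K A] [Module.Finite K A] :
    (∀ X Y : Modc A, FinGen X → FinGen Y → radInf X Y = ⊥) ↔
    (∃ (ι : Type u) (_ : Finite ι) (F : ι → Modc A),
      ∀ X : Modc A, FinGen X → Indec X → ∃ i, Nonempty (X ≃ₗ[Aᵐᵒᵖ] F i)) := by
  have : IsArtinianRing Aᵐᵒᵖ := IsArtinianRing.of_finite K Aᵐᵒᵖ
  refine ⟨finite_type_of_radInf_eq_bot K, ?_⟩
  rintro ⟨ι, _, F, hF⟩ X Y - -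
  exact radInf_eq_bot_of_finite_type F hF X Y
end

section
/- Let A be an artin algebra and C a component of Γ_A without external short paths. Then the additive subcategory add(C) of mod A is closed under extensions: if 0 → X → E → Z → 0 is a short exact sequence in mod A with X and Z in add(C), then E belongs to add(C). -/
universe u

variable {A : Type u} [Ring A]

section ArtinAlgebra

variable {C : Set (Modc A)}

theorem FinGen.of_retract {M N : Modc A} (hM : FinGen M) (i : N →ₗ[Aᵐᵒᵖ] M) (p : M →ₗ[Aᵐᵒᵖ] N)
    (h : p ∘ₗ i = LinearMap.id) : FinGen N := by
  have : Module.Finite Aᵐᵒᵖ M := hM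
  exact Module.Finite.of_surjective p fun y => ⟨i y, LinearMap.congr_fun h y⟩

theorem InAdd.of_linearEquiv {M N : Modc A} (e : M ≃ₗ[Aᵐᵒᵖ] N) (h : InAdd C N) : InAdd C M := by
  obtain ⟨k, F, hF, ⟨e'⟩⟩ := h
  exact ⟨k, F, hF, ⟨e.trans e'⟩⟩

theorem inAdd_of_mem {M : Modc A} (h : M ∈ C) : InAdd C M :=
  ⟨1, fun _ => M, fun _ => h, ⟨(LinearEquiv.funUnique (Fin 1) Aᵐᵒᵖ M).symm⟩⟩

theorem inAdd_of_subsingleton {M : Modc A} [Subsingleton M] : InAdd C M :=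
  ⟨0, Fin.elim0, fun i => i.elim0, ⟨⟨0, 0, fun _ => Subsingleton.elim _ _,
    fun _ => Subsingleton.elim _ _⟩⟩⟩

theorem inAdd_of_finite {ι : Type*} [Finite ι] {M : Modc A} (F : ι → Modc A) (hF : ∀ i, F i ∈ C)
    (e : M ≃ₗ[Aᵐᵒᵖ] ((i : ι) → F i)) : InAdd C M := by
  obtain ⟨n, ⟨u⟩⟩ := Finite.exists_equiv_fin ι
  exact ⟨n, fun i => F (u.symm i), fun i => hF _,
    ⟨e.trans (LinearEquiv.piCongrLeft Aᵐᵒᵖ (fun i => F i) u.symm).symm⟩⟩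

theorem InAdd.prod {M N : Modc A} (hM : InAdd C M) (hN : InAdd C N) :
    InAdd C (ModuleCat.of Aᵐᵒᵖ (M × N)) := by
  obtain ⟨k, F, hF, ⟨e⟩⟩ := hM
  obtain ⟨l, G, hG, ⟨e'⟩⟩ := hN
  refine inAdd_of_finite (ι := Fin k ⊕ Fin l) (Sum.elim F G : _ → Modc A)
    (by rintro (i | i) <;> simp [hF, hG])
    ((e.prodCongr e').trans
      (LinearEquiv.sumPiEquivProdPi Aᵐᵒᵖ (Fin k) (Fin l) fun i => (Sum.elim F G i : Modc A)).symm)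

/-- A module over an Artinian ring lies in `add C` once all its indecomposable
direct summands lie in `C`. -/
theorem inAdd_of_indec_retract_mem [IsArtinianRing Aᵐᵒᵖ] {M : Modc A} (hM : FinGen M)
    (h : ∀ Y : Modc A, Indec Y → IsDirectSummandOf Y M → Y ∈ C) : InAdd C M := by
  have : Module.Finite Aᵐᵒᵖ M := hM
  suffices H : ∀ N : Submodule Aᵐᵒᵖ M, (∃ p : M →ₗ[Aᵐᵒᵖ] N, p ∘ₗ N.subtype = LinearMap.id) →
      InAdd C (ModuleCat.of Aᵐᵒᵖ N) from
    InAdd.of_linearEquiv (N := ModuleCat.of Aᵐᵒᵖ (⊤ : Submodule Aᵐᵒᵖ M))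
      Submodule.topEquiv.symm
      (H ⊤ ⟨Submodule.topEquiv.symm.toLinearMap, rfl⟩)
  intro N
  induction N using WellFoundedLT.induction with
  | ind N ih =>
  rintro ⟨p, hp⟩
  rcases subsingleton_or_nontrivial N with hs | hnt
  · exact inAdd_of_subsingleton (M := ModuleCat.of Aᵐᵒᵖ N)
  by_cases hi : Indec (ModuleCat.of Aᵐᵒᵖ N)
  · exact inAdd_of_mem (h _ hi ⟨N.subtype, p, hp⟩)
  obtain ⟨e, he, he0, he1⟩ : ∃ e : N →ₗ[Aᵐᵒᵖ] N, e ∘ₗ e = e ∧ e ≠ 0 ∧ e ≠ LinearMap.id := by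
    by_contra! hcon
    exact hi ⟨hnt, fun e he => or_iff_not_imp_left.2 (hcon e he)⟩
  have key : ∀ d : N →ₗ[Aᵐᵒᵖ] N, d ∘ₗ d = d → d ≠ LinearMap.id →
      InAdd C (ModuleCat.of Aᵐᵒᵖ (LinearMap.range d)) := by
    intro d hd hd1
    have hinj := N.injective_subtype
    let w := Submodule.equivMapOfInjective N.subtype hinj (LinearMap.range d)
    refine InAdd.of_linearEquiv (N := ModuleCat.of Aᵐᵒᵖ ((LinearMap.range d).map N.subtype)) w
      (ih _ (lt_of_le_of_ne (Submodule.map_subtype_le _ _) ?_)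
        ⟨w.toLinearMap ∘ₗ d.rangeRestrict ∘ₗ p, ?_⟩)
    · intro heq
      apply hd1
      ext1 x
      obtain ⟨y, ⟨z, rfl⟩, hy⟩ : (x : M) ∈ (LinearMap.range d).map N.subtype := by
        rw [heq]
        exact x.2
      obtain rfl : d z = x := hinj hy
      exact LinearMap.congr_fun hd z
    · ext1 ⟨x, y, ⟨z, rfl⟩, rfl⟩
      have h1 : p (d z : M) = d z := LinearMap.congr_fun hp _
      have h2 : d (d z) = d z := LinearMap.congr_fun hd z
      apply Subtype.ext
      simp [w, h1, h2]
  have hker : LinearMap.ker e = LinearMap.range (LinearMap.id - e) :=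
    LinearMap.IsIdempotentElem.ker_eq_range he
  have h1 := key e he he1
  have h2 : InAdd C (ModuleCat.of Aᵐᵒᵖ (LinearMap.ker e)) := by
    rw [hker]
    exact key _ (IsIdempotentElem.one_sub (a := (e : Module.End Aᵐᵒᵖ N)) he)
      fun h' => he0 (by simpa using h')
  exact (h1.prod h2).of_linearEquiv
    (Submodule.prodEquivOfIsCompl _ _ (LinearMap.IsIdempotentElem.isCompl he)).symm

theorem IsARComponent.mem_of_linearEquiv (hC : IsARComponent C) {X Y : Modc A} (hX : X ∈ C)
    (hY : FinGen Y) (hY' : Indec Y) (e : X ≃ₗ[Aᵐᵒᵖ] Y) : Y ∈ C :=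
  hC.2.2.1 X hX Y ⟨(hC.2.1 X hX).1, hY, (hC.2.1 X hX).2, hY', Or.inl ⟨e⟩⟩

theorem InAdd.exists_mem_comp_ne_zero {X Y : Modc A} (hX : InAdd C X) {φ : X →ₗ[Aᵐᵒᵖ] Y}
    (hφ : φ ≠ 0) : ∃ X' ∈ C, ∃ u : X' →ₗ[Aᵐᵒᵖ] X, φ ∘ₗ u ≠ 0 := by
  obtain ⟨k, F, hF, ⟨e⟩⟩ := hX
  by_contra! hcon
  have h : φ ∘ₗ e.symm.toLinearMap = 0 := LinearMap.pi_ext' fun i => by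
    rw [LinearMap.comp_assoc, hcon _ (hF i), LinearMap.zero_comp]
  apply hφ
  ext1 x
  simpa using LinearMap.congr_fun h (e x)

theorem InAdd.exists_mem_ne_zero_comp {Y Z : Modc A} (hZ : InAdd C Z) {ψ : Y →ₗ[Aᵐᵒᵖ] Z}
    (hψ : ψ ≠ 0) : ∃ Z' ∈ C, ∃ v : Z →ₗ[Aᵐᵒᵖ] Z', v ∘ₗ ψ ≠ 0 := by
  obtain ⟨k, F, hF, ⟨e⟩⟩ := hZ
  by_contra! hcon
  apply hψ
  ext1 y
  apply e.injective
  ext1 i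
  simpa using LinearMap.congr_fun (hcon _ (hF i) (LinearMap.proj i ∘ₗ e.toLinearMap)) y

/-- Without external short paths, an indecomposable module outside `C` cannot receive a nonzero
map from `add C` and also have a nonzero map to `add C`. -/
theorem eq_zero_or_eq_zero_of_not_hasExtShortPath (hC : IsARComponent C)
    (hne : ¬ HasExtShortPath C) {X Y Z : Modc A} (hX : InAdd C X) (hZ : InAdd C Z)
    (hY : FinGen Y) (hY' : Indec Y) (hYC : Y ∉ C) (φ : X →ₗ[Aᵐᵒᵖ] Y) (ψ : Y →ₗ[Aᵐᵒᵖ] Z) :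
    φ = 0 ∨ ψ = 0 := by
  by_contra! ⟨hφ, hψ⟩
  obtain ⟨X', hX', u, hu⟩ := hX.exists_mem_comp_ne_zero hφ
  obtain ⟨Z', hZ', v, hv⟩ := hZ.exists_mem_ne_zero_comp hψ
  exact hne ⟨X', Y, Z', hX', hZ', hYC, hY, hY',
    ⟨_, hu, fun hb => hYC (hC.mem_of_linearEquiv hX' hY hY' (LinearEquiv.ofBijective _ hb))⟩,
    ⟨_, hv, fun hb => hYC (hC.mem_of_linearEquiv hZ' hY hY' (LinearEquiv.ofBijective _ hb).symm)⟩⟩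

end ArtinAlgebra

/-- If a component `C` of `Γ_A` has no external short paths,
then `add C` is closed under extensions. -/
theorem addC_closed_under_extensions
    (K : Type u) [CommRing K] [IsArtinianRing K]
    (A : Type u) [Ring A] [Algebra K A] [Module.Finite K A]
    (C : Set (Modc A)) (hC : IsARComponent C) (hne : ¬ HasExtShortPath C)
    (X E Z : Modc A) (hE : FinGen E)
    (f : X →ₗ[Aᵐᵒᵖ] E) (g : E →ₗ[Aᵐᵒᵖ] Z)
    (hf : Function.Injective f) (hg : Function.Surjective g)
    (hfg : LinearMap.range f = LinearMap.ker g)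
    (hX : InAdd C X) (hZ : InAdd C Z) : InAdd C E := by
  have : IsArtinianRing Aᵐᵒᵖ := IsArtinianRing.of_finite K Aᵐᵒᵖ
  refine inAdd_of_indec_retract_mem hE fun Y hY ⟨i, p, hip⟩ => ?_
  have hYfin : FinGen Y := hE.of_retract i p hip
  by_contra hYC
  have hcomp : ∀ {W : Modc A}, InAdd C W → ∀ (φ : W →ₗ[Aᵐᵒᵖ] Y) (ψ : Y →ₗ[Aᵐᵒᵖ] W),
      φ ∘ₗ ψ ≠ LinearMap.id := by
    intro W hW φ ψ hid
    have := hY.1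
    have h0 : φ ∘ₗ ψ = 0 := by
      rcases eq_zero_or_eq_zero_of_not_hasExtShortPath hC hne hW hW hYfin hY hYC φ ψ with h | h <;>
        simp [h]
    obtain ⟨y, hy⟩ := exists_ne (0 : Y)
    exact hy (LinearMap.congr_fun (hid.symm.trans h0) y)
  rcases eq_zero_or_eq_zero_of_not_hasExtShortPath hC hne hX hZ hYfin hY hYC
    (p ∘ₗ f) (g ∘ₗ i) with h | h
  · have hle : LinearMap.ker g ≤ LinearMap.ker p := by
      rw [← hfg, LinearMap.range_le_ker_iff]
      exact h
    refine hcomp hZ ((LinearMap.ker g).liftQ p hle ∘ₗ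
      (g.quotKerEquivOfSurjective hg).symm.toLinearMap) (g ∘ₗ i) ?_
    ext1 y
    have hq : (g.quotKerEquivOfSurjective hg).symm (g (i y)) = (LinearMap.ker g).mkQ (i y) := by
      rw [LinearEquiv.symm_apply_eq]
      rfl
    simpa [hq] using LinearMap.congr_fun hip y
  · have hmem : ∀ y, i y ∈ LinearMap.range f := fun y => hfg ▸ LinearMap.congr_fun h y
    refine hcomp hX (p ∘ₗ f) ((LinearEquiv.ofInjective f hf).symm.toLinearMap ∘ₗ
      i.codRestrict (LinearMap.range f) hmem) ?_
    ext1 y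
    have hq : f ((LinearEquiv.ofInjective f hf).symm ⟨i y, hmem y⟩) = i y :=
      congrArg Subtype.val ((LinearEquiv.ofInjective f hf).apply_symm_apply ⟨i y, hmem y⟩)
    simpa [LinearMap.codRestrict, hq] using LinearMap.congr_fun hip y
end
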